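/- arXiv:2506.17216 — 5 statements merged into one kernel-verified Lean document; each statement's English description precedes it below -/
import Mathlib

section
/- If 𝒟 is a symmetric (15,8,4)-design of type (NC), then Aut(𝒟) is a semidirect product: there exist a normal subgroup N of Aut(𝒟) isomorphic to (ZMod 2)³ and a subgroup H of Aut(𝒟) isomorphic to the Frobenius group C₇ ⋊ C₃ of order 21 (the unique nonabelian group of order 21), with N ∩ H trivial and N · H = Aut(𝒟). -/
/-- A symmetric (15,8,4)-design: 15 blocks, each an 8-element subset of `Fin 15`,
any two distinct blocks meeting in exactly 4 points. -/
def IsDesign (B : Finset (Finset (Fin 15))) : Prop :=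
  B.card = 15 ∧ (∀ b ∈ B, b.card = 8) ∧
    ∀ b ∈ B, ∀ b' ∈ B, b ≠ b' → (b ∩ b').card = 4

private lemma exists_preimage' {β : Type*} [Finite β] {P : β → Prop} {F : β → β}
    (hF : Function.Injective F) (h : ∀ b, P b → P (F b)) {b : β} (hb : P b) :
    ∃ b', P b' ∧ F b' = b := by
  have hGinj : Function.Injective (fun x : {x // P x} => (⟨F x.1, h _ x.2⟩ : {x // P x})) := by
    intro x y hxy
    exact Subtype.ext (hF (congrArg Subtype.val hxy))
  obtain ⟨x, hx⟩ := (Finite.injective_iff_surjective.mp hGinj) ⟨b, hb⟩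
  exact ⟨x.1, x.2, congrArg Subtype.val hx⟩

/-- The full automorphism group of the design with block family `B`. -/
def designAut (B : Finset (Finset (Fin 15))) : Subgroup (Equiv.Perm (Fin 15)) where
  carrier := {σ | ∀ b ∈ B, b.image ⇑σ ∈ B}
  one_mem' := by intro b hb; simpa using hb
  mul_mem' := by
    intro a c ha hc b hb
    have := ha _ (hc b hb)
    simpa [Finset.image_image, Equiv.Perm.coe_mul] using this
  inv_mem' := by
    intro σ hσ b hb
    obtain ⟨b', hb', hEq⟩ := exists_preimage' (F := fun s => Finset.image (⇑σ) s)
      (Finset.image_injective σ.injective) (fun s hs => hσ s hs) hb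
    rw [← hEq, Finset.image_image]
    have : ⇑σ⁻¹ ∘ ⇑σ = id := by
      funext x; simp
    rw [this, Finset.image_id]
    exact hb'

/-- `O` is a center point of the block family `B`. -/
def IsCenter (B : Finset (Finset (Fin 15))) (O : Finset (Fin 15)) : Prop :=
  O ∈ B ∧ ∀ b ∈ B, b ≠ O → symmDiff O b ∈ B

/-- The point set whose indicator function is given by the binary digits of `m`. -/
def pointsOfMask (m : ℕ) : Finset (Fin 15) :=
  Finset.univ.filter fun p => m.testBit p

/-- Bit masks of a reference design: seven complements of Fano lines doubled along the map
`i ↦ i + 7`, followed by eight transversals through the point `14`. -/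
def referenceMasks : List ℕ :=
  [13545, 10707, 5031, 10062, 3741, 7482, 14964,
    16511, 19432, 22353, 28195, 23750, 30989, 29338, 26036]

/-- The block family of the reference design. -/
def referenceBlocks : Finset (Finset (Fin 15)) :=
  (referenceMasks.map pointsOfMask).toFinset

/-- Base-four digits recording the number of blocks of the reference design through a triple of
distinct points. -/
def tripleTable : ℕ := 3477603674832557407617098448651461921534109777655448753452048254842416459296643360312930782168745553958130913730127902773385241415197652444328556783121091769229825120613342243304806296862289693257957254414819343985600901189768412710682314541404099833241600057375043704207658463135028926340331418222478149139568012344351099027558778719793119701618799180741778926183643328260787133910482134903344171579847497566061678785102309451335765328058314752761017022126067962464413449711741015667261672009301204443392627367208051153477376241044261448561331467108400871599197721870549237781084790071853266435782436289425144384883683805471376116083499109567611590308964952963057452017094444508015677794761851921290268754675019590032533685513479403080372600730536159504403458236155435092395094263065338276036904494898348691718177191786162474719933268237146488496165133843619373543714240655379975179195603680620651542958954923383557334075224151183014326120310785426406522908896864587731379200976912647199476820161561660993754133748743618354840089285642657404070170767257762225231910701496545656821015127484440215276939915447761713154174542004382908465777362386518476450892758027755726703211653027601243109224926852719778277122131112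94411124755176729710446807790020398499201279726783390579478582422790950714605381525881157757137990451291025911888156339397485191689314903695114255768250326594111454450910386090721359703998308012834200449016388961318895898572101146880225276991693672712271802284691851049113518558409047283372295818137597601125629078334628264341340837591410635340726433755331352521415881071668541226584747413103898480965238561849408846204460131560761865334540324610736295835656788511494972392240119196403998882390352424130089077264738091935593551403963721537233616949539276785379289133938018516329698264334847295324395095393256643257852261544397286891112364059707448172810961388870322828633583998125855596396188444819972273583517401045486800262864253231375958818771973502944632578528937347213215414408466590653872862478204928

/-- The number of blocks of the reference design through three distinct points. -/
def tripleCount (p q r : ℕ) : ℕ :=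
  (tripleTable >>> (2 * (225 * p + 15 * q + r))) % 4

lemma tripleCount_eq : ∀ p q r : Fin 15, p ≠ q → p ≠ r → q ≠ r →
    tripleCount p q r =
      referenceMasks.countP fun m => m.testBit p && (m.testBit q && m.testBit r) := by
  decide +kernel

/-- Check triples of positions containing the last two given ones. -/
def checkPairs (n x i y : ℕ) : List ℕ → Bool
  | [] => true
  | z :: l => tripleCount i l.length n == tripleCount y z x && checkPairs n x i y l

/-- Check that the value `x` at position `n` is compatible with the earlier values. -/
def checkNext (n x : ℕ) : List ℕ → Bool
  | [] => true
  | y :: l => x != y && (checkPairs n x l.length y l && checkNext n x l)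

/-- All value lists (latest value first) of length `n + 1` of partial injections fixing `0`
and preserving `tripleCount`. -/
def partialMaps : ℕ → List (List ℕ)
  | 0 => [[0]]
  | n + 1 => (partialMaps n).flatMap fun l =>
      ((List.range 15).filter fun x => checkNext (n + 1) x l).map (· :: l)

/-- The values `f (n - 1), …, f 0`. -/
def valuesBelow (f : ℕ → ℕ) : ℕ → List ℕ
  | 0 => []
  | n + 1 => f n :: valuesBelow f n

lemma length_valuesBelow (f : ℕ → ℕ) (n : ℕ) : (valuesBelow f n).length = n := by
  induction n with
  | zero => rfl
  | succ n ih => simp [valuesBelow, ih]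

section Search

variable {f : ℕ → ℕ} (hlt : ∀ i < 15, f i < 15)
  (hinj : ∀ i < 15, ∀ j < 15, f i = f j → i = j)
  (hf : ∀ i < 15, ∀ j < 15, ∀ k < 15, i ≠ j → i ≠ k → j ≠ k →
    tripleCount i j k = tripleCount (f i) (f j) (f k))

include hf in
lemma checkPairs_valuesBelow {n i : ℕ} (hn : n < 15) (hi : i < n) {m : ℕ} (hm : m ≤ i) :
    checkPairs n (f n) i (f i) (valuesBelow f m) = true := by
  induction m with
  | zero => rfl
  | succ m ih =>
    simp only [valuesBelow, checkPairs, length_valuesBelow, Bool.and_eq_true, beq_iff_eq]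
    exact ⟨hf i (by omega) m (by omega) n hn (by omega) (by omega) (by omega), ih (by omega)⟩

include hinj hf in
lemma checkNext_valuesBelow {n : ℕ} (hn : n < 15) {m : ℕ} (hm : m ≤ n) :
    checkNext n (f n) (valuesBelow f m) = true := by
  induction m with
  | zero => rfl
  | succ m ih =>
    simp only [valuesBelow, checkNext, length_valuesBelow, Bool.and_eq_true, bne_iff_ne]
    refine ⟨fun h => ?_, checkPairs_valuesBelow hf hn (by omega) le_rfl, ih (by omega)⟩
    have := hinj n hn m (by omega) h
    omega

include hlt hinj hf in
lemma valuesBelow_mem_partialMaps (h0 : f 0 = 0) {n : ℕ} (hn : n ≤ 14) :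
    valuesBelow f (n + 1) ∈ partialMaps n := by
  induction n with
  | zero => simp [valuesBelow, partialMaps, h0]
  | succ n ih =>
    rw [valuesBelow]
    simp only [partialMaps, List.mem_flatMap, List.mem_map, List.mem_filter, List.mem_range]
    exact ⟨_, ih (by omega), f (n + 1),
      ⟨hlt _ (by omega), checkNext_valuesBelow hinj hf (by omega) le_rfl⟩, rfl⟩

end Search

/-- The translation by a codeword of the simplex code, exchanging `i` and `i + 7` on the support
of the codeword. -/
def translationFun (w : ZMod 2 × ZMod 2 × ZMod 2) (p : Fin 15) : Fin 15 :=
  let e (m : ℕ) : ZMod 2 := if m.testBit (p % 7) then 1 else 0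
  if p.val < 14 ∧ w.1 * e 23 + w.2.1 * e 46 + w.2.2 * e 92 = 1 then
    Fin.ofNat 15 ((p + 7) % 14) else p

/-- The map `x ↦ 2 ^ j * x + i` on both copies of `ZMod 7`. -/
def affineFun (i : Fin 7) (j : Fin 3) (p : Fin 15) : Fin 15 :=
  if p.val < 7 then Fin.ofNat 15 ((2 ^ j.val * p.val + i) % 7)
  else if p.val < 14 then Fin.ofNat 15 (7 + (2 ^ j.val * p.val + i) % 7) else 14

lemma exists_of_mem_partialMaps : ∀ l ∈ partialMaps 14, ∃ w j,
    l = (List.finRange 15).reverse.map fun p => (translationFun w (affineFun 0 j p)).val := by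
  decide +kernel

lemma eq_fourteen_of_tripleCount : ∀ p : Fin 15,
    (∀ q, q ≠ p → ∃ r, r ≠ p ∧ r ≠ q ∧ tripleCount p q r = 0) → p = 14 := by
  decide +kernel

lemma exists_tripleCount_fourteen : ∀ q : Fin 15, q ≠ 14 →
    ∃ r : Fin 15, r ≠ 14 ∧ r ≠ q ∧ tripleCount (14 : Fin 15) q r = 0 := by
  decide +kernel

lemma exists_translationFun_affineFun : ∀ p : Fin 15, p ≠ 14 →
    ∃ w i, translationFun w (affineFun i 0 0) = p := by
  decide +kernel

lemma translationFun_add : ∀ v w p,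
    translationFun (v + w) p = translationFun v (translationFun w p) := by
  decide +kernel

lemma translationFun_zero : ∀ p, translationFun 0 p = p := by
  decide +kernel

lemma affineFun_injective : ∀ i j, Function.Injective (affineFun i j) := by
  decide +kernel

lemma affineFun_affineFun : ∀ i j p, affineFun i 0 (affineFun 0 j p) = affineFun i j p := by
  decide +kernel

lemma affineFun_translationFun : ∀ i j w, ∃ v, ∀ p,
    affineFun i j (translationFun w p) = translationFun v (affineFun i j p) := by
  decide +kernel

lemma mem_pointsOfMask {m : ℕ} {p : Fin 15} : p ∈ pointsOfMask m ↔ m.testBit p = true := by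
  simp [pointsOfMask]

lemma image_pointsOfMask {m n : ℕ} {σ : Equiv.Perm (Fin 15)}
    (h : ∀ p : Fin 15, m.testBit p = n.testBit (σ p)) :
    (pointsOfMask m).image σ = pointsOfMask n := by
  ext q
  simp only [Finset.mem_image, mem_pointsOfMask, h]
  exact ⟨fun ⟨p, hp, hpq⟩ => hpq ▸ hp, fun hq => ⟨σ.symm q, by simpa using hq, by simp⟩⟩

lemma image_mem_referenceBlocks {σ : Equiv.Perm (Fin 15)} {m : ℕ}
    (h : ∃ n ∈ referenceMasks, ∀ p : Fin 15, m.testBit p = n.testBit (σ p)) :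
    (pointsOfMask m).image σ ∈ referenceBlocks := by
  obtain ⟨n, hn, hmn⟩ := h
  rw [image_pointsOfMask hmn]
  exact List.mem_toFinset.2 (List.mem_map_of_mem hn)

lemma mem_designAut_referenceBlocks {σ : Equiv.Perm (Fin 15)}
    (h : ∀ m ∈ referenceMasks, ∃ n ∈ referenceMasks,
      ∀ p : Fin 15, m.testBit p = n.testBit (σ p)) :
    σ ∈ designAut referenceBlocks := by
  intro b hb
  obtain ⟨m, hm, rfl⟩ := List.mem_map.1 (List.mem_toFinset.1 hb)
  exact image_mem_referenceBlocks (h m hm)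

/-- The action of the simplex code by translations. -/
def translationHom :
    Multiplicative (ZMod 2 × ZMod 2 × ZMod 2) →* designAut referenceBlocks where
  toFun w := ⟨⟨translationFun w.toAdd, translationFun w.toAdd,
      fun p => by rw [← translationFun_add, CharTwo.add_self_eq_zero, translationFun_zero],
      fun p => by rw [← translationFun_add, CharTwo.add_self_eq_zero, translationFun_zero]⟩,
    mem_designAut_referenceBlocks (by
      generalize w.toAdd = v
      revert v
      decide +kernel)⟩
  map_one' := Subtype.ext (Equiv.ext translationFun_zero)
  map_mul' v w := Subtype.ext (Equiv.ext (translationFun_add v.toAdd w.toAdd))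

/-- The automorphism of the reference design acting by `x ↦ 2 ^ j * x + i`. -/
noncomputable def affineAut (i : Fin 7) (j : Fin 3) : designAut referenceBlocks :=
  ⟨Equiv.ofBijective (affineFun i j) (Finite.injective_iff_bijective.1 (affineFun_injective i j)),
    mem_designAut_referenceBlocks (by
      simp only [Equiv.ofBijective_apply]
      revert i j
      decide +kernel)⟩

lemma affineAut_apply (i : Fin 7) (j : Fin 3) (p : Fin 15) :
    (affineAut i j : Equiv.Perm (Fin 15)) p = affineFun i j p := rfl

lemma tripleCount_eq_card {p q r : Fin 15} (hpq : p ≠ q) (hpr : p ≠ r) (hqr : q ≠ r) :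
    tripleCount p q r = (referenceBlocks.filter fun b => p ∈ b ∧ q ∈ b ∧ r ∈ b).card := by
  have hnodup : (referenceMasks.map pointsOfMask).Nodup := by decide +kernel
  have hfilter : (referenceBlocks.filter fun b => p ∈ b ∧ q ∈ b ∧ r ∈ b) =
      ((referenceMasks.map pointsOfMask).filter fun b => p ∈ b ∧ q ∈ b ∧ r ∈ b).toFinset := by
    ext b
    simp [referenceBlocks]
  rw [tripleCount_eq p q r hpq hpr hqr, hfilter, List.toFinset_card_of_nodup (hnodup.filter _),
    List.filter_map, List.length_map, List.countP_eq_length_filter]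
  congr 2
  ext m
  simp [mem_pointsOfMask]

lemma tripleCount_map {σ : Equiv.Perm (Fin 15)} (hσ : σ ∈ designAut referenceBlocks)
    {p q r : Fin 15} (hpq : p ≠ q) (hpr : p ≠ r) (hqr : q ≠ r) :
    tripleCount (σ p) (σ q) (σ r) = tripleCount p q r := by
  rw [tripleCount_eq_card hpq hpr hqr, tripleCount_eq_card (by simpa) (by simpa) (by simpa)]
  symm
  apply Finset.card_bij (fun b _ => b.image σ)
  · intro b hb
    rw [Finset.mem_filter] at hb ⊢
    exact ⟨hσ b hb.1, by simpa using hb.2⟩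
  · intro b _ c _ h
    exact Finset.image_injective σ.injective h
  · intro b hb
    rw [Finset.mem_filter] at hb
    refine ⟨b.image ⇑σ⁻¹, ?_, ?_⟩
    · rw [Finset.mem_filter]
      refine ⟨(designAut referenceBlocks).inv_mem hσ b hb.1, ?_⟩
      simp only [Finset.mem_image]
      exact ⟨⟨_, hb.2.1, by simp⟩, ⟨_, hb.2.2.1, by simp⟩, ⟨_, hb.2.2.2, by simp⟩⟩
    · ext x
      simp

lemma apply_fourteen {σ : Equiv.Perm (Fin 15)} (hσ : σ ∈ designAut referenceBlocks) :
    σ 14 = 14 := by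
  apply eq_fourteen_of_tripleCount
  intro q hq
  have hq' : σ.symm q ≠ 14 := fun h => hq (by rw [← h]; simp)
  obtain ⟨r, hr, hrq, h⟩ := exists_tripleCount_fourteen _ hq'
  refine ⟨σ r, by simpa, fun h => hrq (by rw [← h]; simp), ?_⟩
  rw [← h, ← tripleCount_map hσ (Ne.symm hq') (Ne.symm hr) (Ne.symm hrq)]
  simp

lemma exists_eq_of_apply_zero {σ : Equiv.Perm (Fin 15)} (hσ : σ ∈ designAut referenceBlocks)
    (h0 : σ 0 = 0) : ∃ w j, ∀ p, σ p = translationFun w (affineFun 0 j p) := by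
  let f : ℕ → ℕ := fun k => σ (Fin.ofNat 15 k)
  have hfin : ∀ k (hk : k < 15), f k = σ ⟨k, hk⟩ := by
    intro k hk
    simp only [f]
    congr 2
    exact Fin.ext (Nat.mod_eq_of_lt hk)
  have hmem : valuesBelow f 15 ∈ partialMaps 14 := by
    refine valuesBelow_mem_partialMaps (fun i _ => (σ _).isLt) ?_ ?_ ?_ le_rfl
    · intro i hi j hj h
      change f i = f j at h
      rw [hfin i hi, hfin j hj] at h
      simpa using σ.injective (Fin.ext h)
    · intro i hi j hj k hk hij hik hjk
      change _ = tripleCount (f i) (f j) (f k)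
      rw [hfin i hi, hfin j hj, hfin k hk]
      exact (tripleCount_map hσ (p := ⟨i, hi⟩) (q := ⟨j, hj⟩) (r := ⟨k, hk⟩)
        (by simpa) (by simpa) (by simpa)).symm
    · exact congrArg Fin.val h0
  obtain ⟨w, j, h⟩ := exists_of_mem_partialMaps _ hmem
  refine ⟨w, j, fun p => Fin.ext ?_⟩
  have hval : valuesBelow f 15 = (List.finRange 15).reverse.map fun p => (σ p).val := rfl
  rw [hval] at h
  exact List.map_inj_left.1 h p (by simp)

lemma exists_translationHom_mul_affineAut (σ : designAut referenceBlocks) :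
    ∃ w i j, σ = translationHom w * affineAut i j := by
  have hne : (σ : Equiv.Perm (Fin 15)) 0 ≠ 14 := by
    rw [← apply_fourteen σ.2]
    simp
  obtain ⟨v, i, hvi⟩ := exists_translationFun_affineFun _ hne
  obtain ⟨w, j, hwj⟩ := exists_eq_of_apply_zero
    ((translationHom (.ofAdd v) * affineAut i 0)⁻¹ * σ).2 (by
      rw [Subgroup.coe_mul, Subgroup.coe_inv, Equiv.Perm.mul_apply, Equiv.Perm.inv_eq_iff_eq,
        ← hvi]
      rfl)
  obtain ⟨u, hu⟩ := affineFun_translationFun i 0 w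
  refine ⟨.ofAdd (v + u), i, j, ?_⟩
  rw [← mul_inv_cancel_left (translationHom (.ofAdd v) * affineAut i 0) σ]
  refine Subtype.ext (Equiv.ext fun p => ?_)
  rw [Subgroup.coe_mul, Equiv.Perm.mul_apply, hwj]
  change translationFun v (affineFun i 0 _) = translationFun (v + u) (affineFun i j p)
  rw [hu, affineFun_affineFun, translationFun_add]

lemma eq_one_of_image_translationHom {w : Multiplicative (ZMod 2 × ZMod 2 × ZMod 2)}
    (h : (pointsOfMask 16511).image (translationHom w : Equiv.Perm (Fin 15)) =
      pointsOfMask 16511) : w = 1 := by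
  have key : ∀ v, (∀ p : Fin 15, Nat.testBit 16511 p = true →
      Nat.testBit 16511 (translationFun v p) = true) → v = 0 := by decide +kernel
  refine Multiplicative.toAdd.injective (key w.toAdd fun p hp => ?_)
  rw [← mem_pointsOfMask] at hp ⊢
  rw [← h]
  exact Finset.mem_image_of_mem _ hp

lemma image_affineAut (i : Fin 7) (j : Fin 3) :
    (pointsOfMask 16511).image (affineAut i j : Equiv.Perm (Fin 15)) = pointsOfMask 16511 := by
  apply image_pointsOfMask
  simp only [affineAut_apply]
  revert i j
  decide +kernel

lemma translationHom_injective : Function.Injective translationHom := by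
  rw [injective_iff_map_eq_one]
  intro w hw
  apply eq_one_of_image_translationHom
  simp [hw]

/-- The stabilizer of the block `{0, …, 6, 14}` in the automorphism group of the reference
design. -/
def blockStabilizer : Subgroup (designAut referenceBlocks) where
  carrier := {σ | (pointsOfMask 16511).image (σ : Equiv.Perm (Fin 15)) = pointsOfMask 16511}
  one_mem' := by simp
  mul_mem' := by
    intro σ τ hσ hτ
    rw [Set.mem_ofPred_eq] at *
    rw [Subgroup.coe_mul, Equiv.Perm.coe_mul, ← Finset.image_image, hτ, hσ]
  inv_mem' := by
    intro σ hσ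
    rw [Set.mem_ofPred_eq] at *
    nth_rw 1 [← hσ]
    rw [Finset.image_image, ← Equiv.Perm.coe_mul, ← Subgroup.coe_mul, inv_mul_cancel]
    simp

lemma affineAut_mem_blockStabilizer (i : Fin 7) (j : Fin 3) : affineAut i j ∈ blockStabilizer :=
  image_affineAut i j

lemma affineAut_bijective : Function.Bijective fun x : Fin 7 × Fin 3 =>
    (⟨affineAut x.1 x.2, affineAut_mem_blockStabilizer x.1 x.2⟩ : blockStabilizer) := by
  constructor
  · have key : ∀ x y : Fin 7 × Fin 3,
        (∀ p, affineFun x.1 x.2 p = affineFun y.1 y.2 p) → x = y := by decide +kernel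
    intro x y h
    refine key x y fun p => ?_
    rw [← affineAut_apply, ← affineAut_apply, Subtype.mk.inj h]
  · rintro ⟨σ, hσ⟩
    obtain ⟨w, i, j, rfl⟩ := exists_translationHom_mul_affineAut σ
    have hw := (Subgroup.mul_mem_cancel_right _ (affineAut_mem_blockStabilizer i j)).1 hσ
    refine ⟨(i, j), Subtype.ext ?_⟩
    simp [eq_one_of_image_translationHom hw]

lemma card_blockStabilizer : Nat.card blockStabilizer = 21 := by
  rw [← Nat.card_congr (Equiv.ofBijective _ affineAut_bijective)]
  simp

lemma not_commute_blockStabilizer : ¬ ∀ a b : blockStabilizer, a * b = b * a := by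
  intro h
  have key : affineFun 1 0 (affineFun 0 1 0) ≠ affineFun 0 1 (affineFun 1 0 0) := by
    decide +kernel
  have := congrArg Subtype.val (h ⟨_, affineAut_mem_blockStabilizer 1 0⟩
    ⟨_, affineAut_mem_blockStabilizer 0 1⟩)
  exact key (congrArg (fun σ : designAut referenceBlocks => (σ : Equiv.Perm (Fin 15)) 0) this)

lemma normal_range_translationHom : translationHom.range.Normal := by
  constructor
  rintro _ ⟨w, rfl⟩ σ
  obtain ⟨v, i, j, rfl⟩ := exists_translationHom_mul_affineAut σ
  obtain ⟨u, hu⟩ := affineFun_translationFun i j w.toAdd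
  have hconj : affineAut i j * translationHom w = translationHom (.ofAdd u) * affineAut i j :=
    Subtype.ext (Equiv.ext hu)
  refine ⟨v * .ofAdd u * v⁻¹, ?_⟩
  rw [mul_assoc _ _ (translationHom w), hconj, map_mul, map_mul, map_inv]
  group

/-- The group is a semidirect product of an elementary abelian normal subgroup of order eight
and a nonabelian subgroup of order `21`. -/
def IsSplitByFrobenius (G : Type*) [Group G] : Prop :=
  ∃ N H : Subgroup G,
    N.Normal ∧
    Nonempty (↥N ≃* Multiplicative (ZMod 2 × ZMod 2 × ZMod 2)) ∧
    (Nat.card ↥H = 21 ∧ ¬ (∀ a b : ↥H, a * b = b * a)) ∧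
    N ⊓ H = ⊥ ∧
    (∀ g : G, ∃ n ∈ N, ∃ h ∈ H, g = n * h)

lemma isSplitByFrobenius_referenceBlocks : IsSplitByFrobenius (designAut referenceBlocks) := by
  refine ⟨translationHom.range, blockStabilizer, normal_range_translationHom,
    ⟨(MonoidHom.ofInjective translationHom_injective).symm⟩,
    ⟨card_blockStabilizer, not_commute_blockStabilizer⟩, ?_, fun σ => ?_⟩
  · rw [eq_bot_iff]
    rintro _ ⟨⟨w, rfl⟩, hw⟩
    simp [eq_one_of_image_translationHom hw]
  · obtain ⟨w, i, j, rfl⟩ := exists_translationHom_mul_affineAut σ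
    exact ⟨_, ⟨w, rfl⟩, _, affineAut_mem_blockStabilizer i j, rfl⟩

lemma IsSplitByFrobenius.of_mulEquiv {G G' : Type*} [Group G] [Group G'] (e : G ≃* G')
    (hG : IsSplitByFrobenius G) : IsSplitByFrobenius G' := by
  obtain ⟨N, H, hN, ⟨f⟩, ⟨hcard, hcomm⟩, hinf, hmul⟩ := hG
  refine ⟨N.map e.toMonoidHom, H.map e.toMonoidHom, hN.map _ e.surjective,
    ⟨(N.equivMapOfInjective _ e.injective).symm.trans f⟩, ⟨?_, fun h => hcomm fun a b => ?_⟩, ?_,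
    fun g => ?_⟩
  · rw [← hcard]
    exact Nat.card_congr (H.equivMapOfInjective _ e.injective).symm.toEquiv
  · apply (H.equivMapOfInjective e.toMonoidHom e.injective).injective
    rw [map_mul, map_mul, h]
  · rw [← Subgroup.map_inf _ _ _ e.injective, hinf, Subgroup.map_bot]
  · obtain ⟨n, hn, h, hh, hg⟩ := hmul (e.symm g)
    refine ⟨e n, Subgroup.mem_map_of_mem _ hn, e h, Subgroup.mem_map_of_mem _ hh, ?_⟩
    rw [← map_mul, ← hg, e.apply_symm_apply]

/-- The block family obtained by relabelling the points. -/
def relabel (σ : Equiv.Perm (Fin 15)) (B : Finset (Finset (Fin 15))) :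
    Finset (Finset (Fin 15)) :=
  B.image (Finset.image σ)

lemma relabel_relabel (σ τ : Equiv.Perm (Fin 15)) (B : Finset (Finset (Fin 15))) :
    relabel σ (relabel τ B) = relabel (σ * τ) B := by
  simp [relabel, Finset.image_image, Function.comp_def]

lemma relabel_one (B : Finset (Finset (Fin 15))) : relabel 1 B = B := by
  have : Finset.image ⇑(1 : Equiv.Perm (Fin 15)) = id := funext fun _ => Finset.image_id
  rw [relabel, this, Finset.image_id]

lemma conj_mem_designAut {B : Finset (Finset (Fin 15))} (σ : Equiv.Perm (Fin 15))
    {τ : Equiv.Perm (Fin 15)} (hτ : τ ∈ designAut B) :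
    σ * τ * σ⁻¹ ∈ designAut (relabel σ B) := by
  intro b hb
  obtain ⟨c, hc, rfl⟩ := Finset.mem_image.1 hb
  refine Finset.mem_image.2 ⟨_, hτ c hc, ?_⟩
  simp [Finset.image_image, Function.comp_def]

/-- Relabelling the points conjugates the automorphism group. -/
def designAutRelabel (σ : Equiv.Perm (Fin 15)) (B : Finset (Finset (Fin 15))) :
    designAut (relabel σ B) ≃* designAut B where
  toFun τ := ⟨σ⁻¹ * τ * σ, by
    have := conj_mem_designAut σ⁻¹ τ.2
    rwa [relabel_relabel, inv_mul_cancel, inv_inv, relabel_one] at this⟩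
  invFun τ := ⟨σ * τ * σ⁻¹, conj_mem_designAut σ τ.2⟩
  left_inv τ := by simp [mul_assoc]
  right_inv τ := by simp [mul_assoc]
  map_mul' τ τ' := by simp [mul_assoc]

/-- Bit masks of six blocks which every design with a noncentral block contains, up to
relabelling. -/
def baseMasks : List ℕ :=
  [32640, 30840, 28815, 5865, 9690, 17340]

/-- Bit masks of the possible further blocks. -/
def candidateMasks : List ℕ :=
    [7710, 7470, 11822, 6990, 20046, 7350, 13878, 6870, 22102, 6630, 10982, 19686, 13158,
    21862, 26214, 7453, 11805, 11565, 11085, 19789, 11445, 13621, 6613, 10965, 19669, 13141,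
    21845, 26197, 10725, 25957, 6939, 19995, 11051, 19755, 19275, 6579, 10931, 19635, 13107,
    21811, 26163, 19155, 21331, 18915, 25443]

/-- Adjacency matrix, one binary digit per entry, of the graph of candidates meeting in four
points. -/
def candidateGraph : ℕ := 19172247304688762056777027643612246481553822496251610686669951571393947727808413854232728759920521816664611345873581084575853987275234026891485770213274894840355584912212205574695569087240922616352122203511281128433019549121139670622011361539112307638192331865970965455759271756696221380763994372719836108531519679377398463067525768731355669728311402635799367362053478902600291274767199944243303270652996099773251796265887163076746487072120115594135963807215906772514741404010536452475089939385805808240306099370742519420962570136725814820350401986215977229312138539062408457551042425316700319011730104417792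

/-- Adjacency of candidates. -/
def candidateAdj (i j : ℕ) : Bool :=
  candidateGraph.testBit (45 * i + j)

/-- The bit mask of a candidate. -/
def candidate (i : ℕ) : ℕ :=
  candidateMasks.getD i 0

/-- Relabellings to the reference design. -/
def relabellings : List (Fin 15 → Fin 15) :=
  [![0, 1, 3, 14, 7, 8, 10, 6, 11, 9, 12, 13, 4, 2, 5],
    ![0, 3, 1, 14, 7, 10, 8, 6, 11, 12, 9, 13, 4, 5, 2],
    ![0, 3, 9, 4, 5, 13, 8, 11, 12, 6, 1, 14, 7, 10, 2],
    ![0, 1, 3, 6, 11, 9, 12, 14, 7, 8, 10, 13, 4, 2, 5],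
    ![0, 1, 12, 2, 13, 4, 10, 9, 6, 11, 3, 14, 7, 8, 5],
    ![0, 3, 1, 6, 11, 12, 9, 14, 7, 10, 8, 13, 4, 5, 2]]

section Clique

variable {α : Type*} (adj : α → α → Bool)

/-- Extend the cliques found by `rec` by one vertex. -/
def cliqueStep (rec : List α → List (List α)) : List α → List (List α)
  | [] => []
  | x :: l => (rec (l.filter (adj x))).map (x :: ·) ++ cliqueStep rec l

/-- All cliques of the given size whose vertices form a sublist of the given list. -/
def cliques : ℕ → List α → List (List α)
  | 0 => fun _ => [[]]
  | n + 1 => fun l => if l.length < n + 1 then [] else cliqueStep adj (cliques n) l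

variable {adj}

lemma mem_cliqueStep {rec : List α → List (List α)} {n : ℕ}
    (hrec : ∀ l T : List α, T.Sublist l → T.Pairwise (adj · ·) → T.length = n → T ∈ rec l)
    {l T : List α} (hT : T.Sublist l) (hadj : T.Pairwise (adj · ·)) (hn : T.length = n + 1) :
    T ∈ cliqueStep adj rec l := by
  induction l with
  | nil => simp [List.sublist_nil.1 hT] at hn
  | cons x l ih =>
    rw [cliqueStep, List.mem_append]
    cases hT with
    | cons _ h => exact Or.inr (ih h)
    | cons_cons _ h =>
      rename_i S
      rw [List.pairwise_cons] at hadj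
      refine Or.inl (List.mem_map_of_mem (hrec _ _ ?_ hadj.2 (by simpa using hn)))
      rw [← List.filter_eq_self.2 hadj.1]
      exact h.filter _

lemma mem_cliques {n : ℕ} : ∀ l T : List α, T.Sublist l → T.Pairwise (adj · ·) →
    T.length = n → T ∈ cliques adj n l := by
  induction n with
  | zero => intro l T _ _ h; simp [cliques, List.length_eq_zero_iff.1 h]
  | succ n ih =>
    intro l T hT hadj hn
    have hlen := hT.length_le
    rw [cliques]
    beta_reduce
    rw [if_neg (by omega)]
    exact mem_cliqueStep ih hT hadj hn

end Clique

/-- The masks of the base blocks and of the candidates in a list. -/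
def completedMasks (T : List ℕ) : List ℕ :=
  baseMasks ++ T.map candidate

lemma cliques_classification : ∀ T ∈ cliques candidateAdj 9 (List.range 45),
    (∃ o ∈ completedMasks T, ∀ m ∈ completedMasks T, m ≠ o → o ^^^ m ∈ completedMasks T) ∨
    ∃ π ∈ relabellings, Function.Injective π ∧ ∀ m ∈ completedMasks T, ∃ n ∈ referenceMasks,
      ∀ p : Fin 15, m.testBit p = n.testBit (π p) := by
  decide +kernel

lemma candidateAdj_of_countP : ∀ i < 45, ∀ j < 45, i ≠ j →
    ((List.finRange 15).countP fun p : Fin 15 =>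
      (candidate i).testBit p && (candidate j).testBit p) = 4 → candidateAdj i j = true := by
  decide +kernel

lemma pointsOfMask_injOn : Set.InjOn pointsOfMask {m | m < 2 ^ 15} := by
  intro m hm n hn h
  rw [Set.mem_ofPred_eq] at hm hn
  refine Nat.eq_of_testBit_eq fun i => ?_
  rcases lt_or_ge i 15 with hi | hi
  · have := Finset.ext_iff.1 h ⟨i, hi⟩
    rw [mem_pointsOfMask, mem_pointsOfMask] at this
    exact Bool.eq_iff_iff.2 this
  · have hpow := Nat.pow_le_pow_right (n := 2) (by norm_num) hi
    rw [Nat.testBit_lt_two_pow (hm.trans_le hpow), Nat.testBit_lt_two_pow (hn.trans_le hpow)]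

lemma nodup_map_pointsOfMask {l : List ℕ} (hl : l.Nodup) (h : ∀ m ∈ l, m < 2 ^ 15) :
    (l.map pointsOfMask).Nodup :=
  (List.nodup_map_iff_inj_on hl).2 fun m hm n hn =>
    pointsOfMask_injOn (h m hm) (h n hn)

lemma card_inter_pointsOfMask (m n : ℕ) : (pointsOfMask m ∩ pointsOfMask n).card =
    (List.finRange 15).countP fun p : Fin 15 => m.testBit p && n.testBit p := by
  have : pointsOfMask m ∩ pointsOfMask n =
      ((List.finRange 15).filter fun p : Fin 15 => m.testBit p && n.testBit p).toFinset := by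
    ext p
    simp [mem_pointsOfMask]
  rw [this, List.toFinset_card_of_nodup ((List.nodup_finRange 15).filter _),
    List.countP_eq_length_filter]

lemma symmDiff_pointsOfMask (m n : ℕ) :
    symmDiff (pointsOfMask m) (pointsOfMask n) = pointsOfMask (m ^^^ n) := by
  ext p
  rw [Finset.mem_symmDiff, mem_pointsOfMask, mem_pointsOfMask, mem_pointsOfMask,
    Nat.testBit_xor]
  cases m.testBit p <;> cases n.testBit p <;> simp

lemma exists_eq_candidate {m : ℕ} (hm : m ∈ candidateMasks) : ∃ i < 45, candidate i = m := by
  obtain ⟨i, hi, rfl⟩ := List.getElem_of_mem hm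
  exact ⟨i, hi, by rw [candidate, List.getD_eq_getElem _ _ hi]⟩

lemma nodup_baseMasks_append : (baseMasks ++ (List.range 45).map candidate).Nodup := by
  decide +kernel

lemma lt_of_mem_baseMasks_append :
    ∀ m ∈ baseMasks ++ (List.range 45).map candidate, m < 2 ^ 15 := by
  decide +kernel

lemma nodup_map_completedMasks {T : List ℕ} (hT : T.Sublist (List.range 45)) :
    ((completedMasks T).map pointsOfMask).Nodup := by
  have hsub : (completedMasks T).Sublist (baseMasks ++ (List.range 45).map candidate) :=
    (List.Sublist.refl _).append (hT.map _)
  exact nodup_map_pointsOfMask (nodup_baseMasks_append.sublist hsub) fun m hm =>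
    lt_of_mem_baseMasks_append m (hsub.subset hm)

lemma card_referenceBlocks : referenceBlocks.card = 15 := by
  rw [referenceBlocks, List.toFinset_card_of_nodup
    (nodup_map_pointsOfMask (by decide +kernel) (by decide +kernel))]
  rfl

lemma card_relabel (σ : Equiv.Perm (Fin 15)) (B : Finset (Finset (Fin 15))) :
    (relabel σ B).card = B.card :=
  Finset.card_image_of_injective _ (Finset.image_injective σ.injective)

/-- A design in normal form without center points has the expected automorphism group. -/
lemma isSplitByFrobenius_of_normalForm {B : Finset (Finset (Fin 15))} (hD : IsDesign B)
    (hNC : ∀ O, ¬ IsCenter B O) (hbase : ∀ m ∈ baseMasks, pointsOfMask m ∈ B)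
    (hB : ∀ b ∈ B, ∃ m ∈ baseMasks ++ candidateMasks, b = pointsOfMask m) :
    IsSplitByFrobenius (designAut B) := by
  obtain ⟨hcard, -, hinter⟩ := hD
  set T := (List.range 45).filter fun i => pointsOfMask (candidate i) ∈ B with hTdef
  have hmemT {i : ℕ} : i ∈ T ↔ i < 45 ∧ pointsOfMask (candidate i) ∈ B := by simp [hTdef]
  have hT : T.Sublist (List.range 45) := List.filter_sublist
  have hmem (m : ℕ) (hm : m ∈ completedMasks T) : pointsOfMask m ∈ B := by
    rcases List.mem_append.1 hm with h | h
    · exact hbase m h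
    · obtain ⟨i, hi, rfl⟩ := List.mem_map.1 h
      exact (hmemT.1 hi).2
  have hexists (b : Finset (Fin 15)) (hb : b ∈ B) : ∃ m ∈ completedMasks T, pointsOfMask m = b := by
    obtain ⟨m, hm, rfl⟩ := hB b hb
    rcases List.mem_append.1 hm with h | h
    · exact ⟨m, List.mem_append_left _ h, rfl⟩
    · obtain ⟨i, hi, rfl⟩ := exists_eq_candidate h
      exact ⟨_, List.mem_append_right _ (List.mem_map_of_mem (hmemT.2 ⟨hi, hb⟩)), rfl⟩
  have hBeq : B = ((completedMasks T).map pointsOfMask).toFinset := by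
    ext b
    simp only [List.mem_toFinset, List.mem_map]
    exact ⟨hexists b, fun ⟨m, hm, h⟩ => h ▸ hmem m hm⟩
  have hlen : T.length = 9 := by
    have h15 : ((completedMasks T).map pointsOfMask).length = 15 := by
      rw [← List.toFinset_card_of_nodup (nodup_map_completedMasks hT), ← hBeq, hcard]
    have h6 : baseMasks.length = 6 := rfl
    rw [List.length_map, completedMasks, List.length_append, List.length_map, h6] at h15
    omega
  have hadj : T.Pairwise (candidateAdj · ·) := by
    have hnd : T.Nodup := List.nodup_range.sublist hT
    refine hnd.pairwise_of_forall_ne fun i hi j hj hij => ?_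
    have hi' := hmemT.1 hi
    have hj' := hmemT.1 hj
    refine candidateAdj_of_countP i hi'.1 j hj'.1 hij ?_
    rw [← card_inter_pointsOfMask]
    refine hinter _ hi'.2 _ hj'.2 fun h => hij ?_
    have hinj := (List.nodup_map_iff_inj_on List.nodup_range).1
      (List.nodup_append.1 nodup_baseMasks_append).2.1
    refine hinj i (List.mem_range.2 hi'.1) j (List.mem_range.2 hj'.1) (pointsOfMask_injOn ?_ ?_ h)
    · exact lt_of_mem_baseMasks_append _
        (List.mem_append_right _ (List.mem_map_of_mem (List.mem_range.2 hi'.1)))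
    · exact lt_of_mem_baseMasks_append _
        (List.mem_append_right _ (List.mem_map_of_mem (List.mem_range.2 hj'.1)))
  rcases cliques_classification T (mem_cliques _ _ hT hadj hlen) with
    ⟨o, ho, hcenter⟩ | ⟨π, -, hπ, hmap⟩
  · refine absurd ⟨hmem o ho, fun b hb hbo => ?_⟩ (hNC (pointsOfMask o))
    obtain ⟨m, hm, rfl⟩ := hexists b hb
    rw [symmDiff_pointsOfMask]
    exact hmem _ (hcenter m hm fun h => hbo (by rw [h]))
  · set σ : Equiv.Perm (Fin 15) :=
      Equiv.ofBijective π (Finite.injective_iff_bijective.1 hπ) with hσ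
    have hsub : relabel σ B ⊆ referenceBlocks := by
      intro c hc
      obtain ⟨b, hb, rfl⟩ := Finset.mem_image.1 hc
      obtain ⟨m, hm, rfl⟩ := hexists b hb
      exact image_mem_referenceBlocks (hmap m hm)
    have heq : relabel σ B = referenceBlocks :=
      Finset.eq_of_subset_of_card_le hsub (by rw [card_referenceBlocks, card_relabel, hcard])
    exact (heq ▸ isSplitByFrobenius_referenceBlocks).of_mulEquiv (designAutRelabel σ B)

/-- The row of a Hadamard matrix attached to a block: the signed indicator function, extended by
`1` at an additional point. -/
def blockSign (b : Finset (Fin 15)) : Option (Fin 15) → ℤ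
  | none => 1
  | some p => if p ∈ b then -1 else 1

lemma blockSign_none (b : Finset (Fin 15)) : blockSign b none = 1 := rfl

lemma blockSign_some_eq_neg_one {b : Finset (Fin 15)} {p : Fin 15} :
    blockSign b (some p) = -1 ↔ p ∈ b := by
  by_cases h : p ∈ b <;> simp [blockSign, h]

lemma blockSign_eq_or (b : Finset (Fin 15)) (x : Option (Fin 15)) :
    blockSign b x = 1 ∨ blockSign b x = -1 := by
  cases x with
  | none => exact Or.inl rfl
  | some p => by_cases h : p ∈ b <;> simp [blockSign, h]

lemma blockSign_mul_self (b : Finset (Fin 15)) (x : Option (Fin 15)) :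
    blockSign b x * blockSign b x = 1 := by
  rcases blockSign_eq_or b x with h | h <;> simp [h]

lemma blockSign_symmDiff (a b : Finset (Fin 15)) (x : Option (Fin 15)) :
    blockSign (symmDiff a b) x = blockSign a x * blockSign b x := by
  cases x with
  | none => rfl
  | some p =>
    by_cases ha : p ∈ a <;> by_cases hb : p ∈ b <;> simp [blockSign, Finset.mem_symmDiff, ha, hb]

lemma blockSign_injective : Function.Injective blockSign := by
  intro a b h
  ext p
  rw [← blockSign_some_eq_neg_one, h, blockSign_some_eq_neg_one]

lemma sum_blockSign (b : Finset (Fin 15)) :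
    ∑ x, blockSign b x = 16 - 2 * (b.card : ℤ) := by
  have (p : Fin 15) : blockSign b (some p) = 1 - 2 * if p ∈ b then 1 else 0 := by
    by_cases h : p ∈ b <;> simp [blockSign, h]
  rw [Fintype.sum_option, Finset.sum_congr rfl fun p _ => this p, Finset.sum_sub_distrib,
    ← Finset.mul_sum, blockSign_none]
  simp
  ring

lemma sum_blockSign_mul (a b : Finset (Fin 15)) :
    ∑ x, blockSign a x * blockSign b x =
      16 - 2 * (a.card : ℤ) - 2 * b.card + 4 * (a ∩ b).card := by
  simp only [← blockSign_symmDiff]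
  have h1 : (symmDiff a b).card + (a ∩ b).card = (a ∪ b).card := by
    rw [← Finset.card_union_of_disjoint]
    · congr 1
      exact symmDiff_sup_inf a b
    · exact disjoint_symmDiff_inf a b
  have h2 := Finset.card_union_add_card_inter a b
  rw [sum_blockSign]
  omega

/-- Parseval's identity for an integral matrix with pairwise orthogonal rows of equal length. -/
lemma sum_sq_eq_of_orthogonal_rows {m n : Type*} [Fintype m] [Fintype n] [DecidableEq m]
    [DecidableEq n] (hcard : Fintype.card m = Fintype.card n) {N : ℤ} (hN : N ≠ 0)
    (M : m → n → ℤ) (hM : ∀ r s, ∑ x, M r x * M s x = if r = s then N else 0) (e : n → ℤ) :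
    ∑ r, (∑ x, M r x * e x) ^ 2 = N * ∑ x, e x ^ 2 := by
  have hN' : (N : ℚ) ≠ 0 := Int.cast_ne_zero.2 hN
  set A : Matrix m n ℚ := Matrix.of fun r x => (M r x : ℚ) with hA
  set v : n → ℚ := fun x => e x with hv
  have hrows : A * A.transpose = (N : ℚ) • (1 : Matrix m m ℚ) := by
    ext r s
    rw [Matrix.mul_apply, Matrix.smul_apply, Matrix.one_apply, smul_eq_mul, mul_ite, mul_one,
      mul_zero]
    simp only [hA, Matrix.transpose_apply, Matrix.of_apply]
    exact_mod_cast hM r s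
  have hcols : A.transpose * A = (N : ℚ) • (1 : Matrix n n ℚ) := by
    have h1 : A * ((N : ℚ)⁻¹ • A.transpose) = 1 := by
      rw [Matrix.mul_smul, hrows, smul_smul, inv_mul_cancel₀ hN', one_smul]
    rw [Matrix.mul_eq_one_comm_of_equiv (Fintype.equivOfCardEq hcard)] at h1
    rw [← h1, Matrix.smul_mul, smul_smul, mul_inv_cancel₀ hN', one_smul]
  have key : dotProduct (A.mulVec v) (A.mulVec v) = N * dotProduct v v := by
    rw [Matrix.dotProduct_mulVec, Matrix.vecMul_mulVec, hcols, Matrix.vecMul_smul,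
      Matrix.vecMul_one, smul_dotProduct, smul_eq_mul]
  have hcast : ((∑ r, (∑ x, M r x * e x) ^ 2 : ℤ) : ℚ) = ((N * ∑ x, e x ^ 2 : ℤ) : ℚ) := by
    push_cast
    simpa [dotProduct, Matrix.mulVec, hA, hv, pow_two] using key
  exact_mod_cast hcast

namespace IsDesign

variable {B : Finset (Finset (Fin 15))} (hD : IsDesign B)

include hD

lemma sum_sign {b : Finset (Fin 15)} (hb : b ∈ B) : ∑ x, blockSign b x = 0 := by
  rw [sum_blockSign, hD.2.1 b hb]
  norm_num

lemma sum_sign_mul {a b : Finset (Fin 15)} (ha : a ∈ B) (hb : b ∈ B) (hab : a ≠ b) :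
    ∑ x, blockSign a x * blockSign b x = 0 := by
  rw [sum_blockSign_mul, hD.2.1 a ha, hD.2.1 b hb, hD.2.2 a ha b hb hab]
  norm_num

lemma sum_sum_sign_mul_sq (e : Option (Fin 15) → ℤ) :
    (∑ x, e x) ^ 2 + ∑ b ∈ B, (∑ x, blockSign b x * e x) ^ 2 = 16 * ∑ x, e x ^ 2 := by
  have hcard : Fintype.card (Option B) = Fintype.card (Option (Fin 15)) := by
    rw [Fintype.card_option, Fintype.card_option, Fintype.card_coe, hD.1, Fintype.card_fin]
  have hself (b : Finset (Fin 15)) : ∑ x, blockSign b x * blockSign b x = 16 := by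
    rw [Finset.sum_congr rfl fun x _ => blockSign_mul_self b x]
    rfl
  have hempty (x : Option (Fin 15)) : blockSign ∅ x = 1 := by cases x <;> rfl
  have hempty' (b : Finset (Fin 15)) (hb : b ∈ B) : ∑ x, blockSign ∅ x * blockSign b x = 0 := by
    rw [← hD.sum_sign hb]
    exact Finset.sum_congr rfl fun x _ => by rw [hempty, one_mul]
  have key := sum_sq_eq_of_orthogonal_rows hcard (by norm_num : (16 : ℤ) ≠ 0)
    (fun (r : Option B) x => blockSign (r.elim ∅ (·.1)) x) (by
      intro r r'
      rcases eq_or_ne r r' with rfl | hne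
      · rw [if_pos rfl]
        exact hself _
      · rw [if_neg hne]
        match r, r', hne with
        | none, none, hne => exact absurd rfl hne
        | none, some b, _ => exact hempty' b.1 b.2
        | some b, none, _ =>
          refine Eq.trans ?_ (hempty' b.1 b.2)
          exact Finset.sum_congr rfl fun x _ => mul_comm _ _
        | some b, some b', hne =>
          exact hD.sum_sign_mul b.2 b'.2 fun h => hne (congrArg some (Subtype.ext h))) e
  rw [Fintype.sum_option (α := B)] at key
  rw [← key, ← Finset.sum_coe_sort B]
  congr 2
  exact Finset.sum_congr rfl fun x _ => by rw [Option.elim_none, hempty, one_mul]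

end IsDesign

lemma sum_eq_card_sub_of_signs {ι : Type*} (s : Finset ι) {t : ι → ℤ}
    (ht : ∀ x, t x = 1 ∨ t x = -1) :
    ∑ x ∈ s, t x = s.card - 2 * ((s.filter fun x => t x = -1).card : ℤ) := by
  have h (x : ι) : t x = 1 - 2 * if t x = -1 then 1 else 0 := by
    rcases ht x with h | h <;> rw [h] <;> norm_num
  rw [Finset.sum_congr rfl fun x _ => h x, Finset.sum_sub_distrib, ← Finset.mul_sum,
    Finset.sum_boole]
  simp

lemma four_mul_sum_quadrant {ι : Type*} [Fintype ι] {u v : ι → ℤ}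
    (hu : ∀ x, u x = 1 ∨ u x = -1) (hv : ∀ x, v x = 1 ∨ v x = -1) {p q : ℤ}
    (hp : p = 1 ∨ p = -1) (hq : q = 1 ∨ q = -1) (f : ι → ℤ) :
    4 * ∑ x with u x = p ∧ v x = q, f x =
      ∑ x, f x + p * ∑ x, f x * u x + q * ∑ x, f x * v x + p * q * ∑ x, f x * (u x * v x) := by
  rw [Finset.sum_filter, Finset.mul_sum, Finset.mul_sum, Finset.mul_sum, Finset.mul_sum,
    ← Finset.sum_add_distrib, ← Finset.sum_add_distrib, ← Finset.sum_add_distrib]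
  refine Finset.sum_congr rfl fun x _ => ?_
  rcases hu x with h1 | h1 <;> rcases hv x with h2 | h2 <;> rcases hp with rfl | rfl <;>
    rcases hq with rfl | rfl <;> rw [h1, h2] <;> norm_num <;> ring

/-- Signs of the first distinguished block on the four classes of points. -/
def firstSign : Fin 4 → ℤ := ![1, 1, -1, -1]

/-- Signs of the second distinguished block on the four classes of points. -/
def secondSign : Fin 4 → ℤ := ![1, -1, 1, -1]

lemma firstSign_eq_or (k : Fin 4) : firstSign k = 1 ∨ firstSign k = -1 := by
  revert k
  decide

lemma secondSign_eq_or (k : Fin 4) : secondSign k = 1 ∨ secondSign k = -1 := by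
  revert k
  decide

lemma eq_of_firstSign_secondSign : ∀ k l : Fin 4, firstSign k = firstSign l →
    secondSign k = secondSign l → k = l := by
  decide

/-- The triple product of the sign vectors of three blocks. -/
def tripleSign (a b c : Finset (Fin 15)) (x : Option (Fin 15)) : ℤ :=
  blockSign c x * (blockSign a x * blockSign b x)

lemma tripleSign_eq_or (a b c : Finset (Fin 15)) (x : Option (Fin 15)) :
    tripleSign a b c x = 1 ∨ tripleSign a b c x = -1 := by
  rw [tripleSign]
  rcases blockSign_eq_or a x with h | h <;> rcases blockSign_eq_or b x with h' | h' <;>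
    rcases blockSign_eq_or c x with h'' | h'' <;> rw [h, h', h''] <;> norm_num

/-- The points with prescribed signs with respect to two blocks. -/
def quadrant (a b : Finset (Fin 15)) (p q : ℤ) : Finset (Option (Fin 15)) :=
  Finset.univ.filter fun x => blockSign a x = p ∧ blockSign b x = q

namespace IsDesign

variable {B : Finset (Finset (Fin 15))}

lemma card_quadrant (hD : IsDesign B) {a b : Finset (Fin 15)} (ha : a ∈ B) (hb : b ∈ B)
    (hab : a ≠ b) {p q : ℤ} (hp : p = 1 ∨ p = -1) (hq : q = 1 ∨ q = -1) :
    (quadrant a b p q).card = 4 := by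
  have h := four_mul_sum_quadrant (blockSign_eq_or a) (blockSign_eq_or b) hp hq fun _ => 1
  simp only [one_mul] at h
  rw [hD.sum_sign ha, hD.sum_sign hb, hD.sum_sign_mul ha hb hab] at h
  rw [Finset.sum_const, Finset.sum_const, Finset.card_univ, Fintype.card_option,
    Fintype.card_fin] at h
  rw [quadrant]
  simp only [nsmul_eq_mul, mul_one, mul_zero, add_zero] at h
  push_cast at h
  omega

lemma four_mul_sum_tripleSign_quadrant (hD : IsDesign B) {a b c : Finset (Fin 15)} (ha : a ∈ B)
    (hb : b ∈ B) (hc : c ∈ B) (hca : c ≠ a) (hcb : c ≠ b) {p q : ℤ} (hp : p = 1 ∨ p = -1)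
    (hq : q = 1 ∨ q = -1) :
    4 * ∑ x ∈ quadrant a b p q, tripleSign a b c x = ∑ x, tripleSign a b c x := by
  have h := four_mul_sum_quadrant (blockSign_eq_or a) (blockSign_eq_or b) hp hq (tripleSign a b c)
  have h1 : ∑ x, tripleSign a b c x * blockSign a x = 0 := by
    rw [← hD.sum_sign_mul hc hb hcb]
    refine Finset.sum_congr rfl fun x _ => ?_
    rw [tripleSign]
    linear_combination blockSign c x * blockSign b x * blockSign_mul_self a x
  have h2 : ∑ x, tripleSign a b c x * blockSign b x = 0 := by
    rw [← hD.sum_sign_mul hc ha hca]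
    refine Finset.sum_congr rfl fun x _ => ?_
    rw [tripleSign]
    linear_combination blockSign c x * blockSign a x * blockSign_mul_self b x
  have h3 : ∑ x, tripleSign a b c x * (blockSign a x * blockSign b x) = 0 := by
    rw [← hD.sum_sign hc]
    refine Finset.sum_congr rfl fun x _ => ?_
    rw [tripleSign]
    linear_combination blockSign c x * blockSign a x ^ 2 * blockSign_mul_self b x +
      blockSign c x * blockSign_mul_self a x
  rw [h1, h2, h3] at h
  rw [quadrant, h]
  ring

lemma sum_tripleSign_left (hD : IsDesign B) {a b : Finset (Fin 15)} (hb : b ∈ B) :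
    ∑ x, tripleSign a b a x = 0 := by
  rw [← hD.sum_sign hb]
  refine Finset.sum_congr rfl fun x _ => ?_
  rw [tripleSign]
  linear_combination blockSign b x * blockSign_mul_self a x

lemma sum_tripleSign_right (hD : IsDesign B) {a b : Finset (Fin 15)} (ha : a ∈ B) :
    ∑ x, tripleSign a b b x = 0 := by
  rw [← hD.sum_sign ha]
  refine Finset.sum_congr rfl fun x _ => ?_
  rw [tripleSign]
  linear_combination blockSign a x * blockSign_mul_self b x

lemma sum_tripleSign (hD : IsDesign B) {a b c : Finset (Fin 15)} (ha : a ∈ B) (hb : b ∈ B)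
    (hab : a ≠ b) (hsd : symmDiff a b ∉ B) (hc : c ∈ B) :
    ∑ x, tripleSign a b c x = 0 ∨ ∑ x, tripleSign a b c x = 8 ∨
      ∑ x, tripleSign a b c x = -8 := by
  rcases eq_or_ne c a with rfl | hca
  · exact Or.inl (hD.sum_tripleSign_left hb)
  rcases eq_or_ne c b with rfl | hcb
  · exact Or.inl (hD.sum_tripleSign_right ha)
  have h4 := hD.four_mul_sum_tripleSign_quadrant ha hb hc hca hcb (Or.inl rfl) (Or.inl rfl)
  have hcard := hD.card_quadrant ha hb hab (Or.inl rfl) (Or.inl rfl)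
  have hlt : ((quadrant a b 1 1).filter fun x => tripleSign a b c x = -1).card < 4 := by
    rw [← hcard]
    refine Finset.card_lt_card (Finset.filter_ssubset.2 ⟨none, ?_, ?_⟩)
    · simp [quadrant, blockSign_none]
    · simp [tripleSign, blockSign_none]
  have hne : ∑ x, tripleSign a b c x ≠ 16 := by
    intro h16
    rw [sum_eq_card_sub_of_signs _ (tripleSign_eq_or a b c), Finset.card_univ,
      Fintype.card_option, Fintype.card_fin] at h16
    have hempty : (Finset.univ.filter fun x => tripleSign a b c x = -1) = ∅ := by
      rw [← Finset.card_eq_zero]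
      push_cast at h16
      omega
    refine hsd ?_
    suffices c = symmDiff a b from this ▸ hc
    refine blockSign_injective (funext fun x => ?_)
    have hx : tripleSign a b c x = 1 := by
      refine (tripleSign_eq_or a b c x).resolve_right fun h => ?_
      exact Finset.notMem_empty x (hempty ▸ Finset.mem_filter.2 ⟨Finset.mem_univ x, h⟩)
    rw [tripleSign] at hx
    rw [blockSign_symmDiff]
    rcases blockSign_eq_or a x with h | h <;> rcases blockSign_eq_or b x with h' | h' <;>
      rw [h, h'] at hx ⊢ <;> linarith
  rw [← h4] at hne ⊢
  rw [sum_eq_card_sub_of_signs _ (tripleSign_eq_or a b c), hcard] at hne ⊢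
  push_cast at hne ⊢
  omega

/-- Exactly four blocks are not orthogonal to the product of two blocks whose symmetric difference
is not a block. -/
lemma card_filter_sum_tripleSign_ne_zero (hD : IsDesign B) {a b : Finset (Fin 15)} (ha : a ∈ B)
    (hb : b ∈ B) (hab : a ≠ b) (hsd : symmDiff a b ∉ B) :
    (B.filter fun c => ∑ x, tripleSign a b c x ≠ 0).card = 4 := by
  have h := hD.sum_sum_sign_mul_sq fun x => blockSign a x * blockSign b x
  have hsq (c : Finset (Fin 15)) (hc : c ∈ B) :
      (∑ x, tripleSign a b c x) ^ 2 = 64 * if ∑ x, tripleSign a b c x ≠ 0 then 1 else 0 := by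
    rcases hD.sum_tripleSign ha hb hab hsd hc with h | h | h <;> rw [h] <;> norm_num
  have hone (x : Option (Fin 15)) : (blockSign a x * blockSign b x) ^ 2 = 1 := by
    linear_combination blockSign a x ^ 2 * blockSign_mul_self b x + blockSign_mul_self a x
  have hsum := Finset.sum_congr rfl hsq
  rw [← Finset.mul_sum, Finset.sum_boole] at hsum
  rw [hD.sum_sign_mul ha hb hab, Finset.sum_congr rfl fun x _ => hone x, Finset.sum_const,
    Finset.card_univ, Fintype.card_option, Fintype.card_fin] at h
  change _ + ∑ c ∈ B, (∑ x, tripleSign a b c x) ^ 2 = _ at h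
  rw [hsum] at h
  norm_num at h
  norm_num
  omega

end IsDesign

/-- The sign with which a block correlates with the product of two given ones. -/
def correlationSign (a b c : Finset (Fin 15)) : ℤ :=
  if ∑ x, tripleSign a b c x = 8 then 1 else -1

/-- The triple product of signs, normalised to be mostly positive. -/
def normalizedSign (a b c : Finset (Fin 15)) (x : Option (Fin 15)) : ℤ :=
  correlationSign a b c * tripleSign a b c x

lemma correlationSign_eq_or (a b c : Finset (Fin 15)) :
    correlationSign a b c = 1 ∨ correlationSign a b c = -1 := by
  rw [correlationSign]
  split_ifs
  · exact Or.inl rfl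
  · exact Or.inr rfl

lemma normalizedSign_eq_or (a b c : Finset (Fin 15)) (x : Option (Fin 15)) :
    normalizedSign a b c x = 1 ∨ normalizedSign a b c x = -1 := by
  rw [normalizedSign]
  rcases correlationSign_eq_or a b c with h | h <;> rcases tripleSign_eq_or a b c x with h' | h' <;>
    rw [h, h'] <;> norm_num

lemma blockSign_eq_mul_normalizedSign (a b c : Finset (Fin 15)) (x : Option (Fin 15)) :
    blockSign c x = correlationSign a b c * (blockSign a x * blockSign b x) *
      normalizedSign a b c x := by
  rw [normalizedSign, tripleSign]
  rcases correlationSign_eq_or a b c with h | h <;> rcases blockSign_eq_or a x with h' | h' <;>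
    rcases blockSign_eq_or b x with h'' | h'' <;> rw [h, h', h''] <;> ring

namespace IsDesign

variable {B : Finset (Finset (Fin 15))} {a b c : Finset (Fin 15)}

lemma sum_normalizedSign (hD : IsDesign B) (ha : a ∈ B) (hb : b ∈ B) (hab : a ≠ b)
    (hsd : symmDiff a b ∉ B) (hc : c ∈ B) (hne : ∑ x, tripleSign a b c x ≠ 0) :
    ∑ x, normalizedSign a b c x = 8 := by
  simp only [normalizedSign]
  rw [← Finset.mul_sum, correlationSign]
  rcases hD.sum_tripleSign ha hb hab hsd hc with h | h | h
  · exact absurd h hne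
  · rw [h]
    norm_num
  · rw [h]
    norm_num

lemma card_filter_quadrant (hD : IsDesign B) (ha : a ∈ B) (hb : b ∈ B) (hab : a ≠ b)
    (hsd : symmDiff a b ∉ B) (hc : c ∈ B) (hne : ∑ x, tripleSign a b c x ≠ 0) {p q : ℤ}
    (hp : p = 1 ∨ p = -1) (hq : q = 1 ∨ q = -1) :
    ((quadrant a b p q).filter fun x => normalizedSign a b c x = -1).card = 1 := by
  have hca : c ≠ a := by
    rintro rfl
    exact hne (hD.sum_tripleSign_left hb)
  have hcb : c ≠ b := by
    rintro rfl
    exact hne (hD.sum_tripleSign_right ha)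
  have h8 := hD.sum_normalizedSign ha hb hab hsd hc hne
  have h := sum_eq_card_sub_of_signs (quadrant a b p q) (normalizedSign_eq_or a b c)
  have h4 : 4 * ∑ x ∈ quadrant a b p q, normalizedSign a b c x = ∑ x, normalizedSign a b c x := by
    simp only [normalizedSign]
    rw [← Finset.mul_sum, ← Finset.mul_sum,
      ← hD.four_mul_sum_tripleSign_quadrant ha hb hc hca hcb hp hq]
    ring
  rw [hD.card_quadrant ha hb hab hp hq] at h
  push_cast at h
  omega

lemma normalizedSign_ne_neg_one_of_ne (hD : IsDesign B) (ha : a ∈ B) (hb : b ∈ B) (hab : a ≠ b)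
    (hsd : symmDiff a b ∉ B) (hc : c ∈ B) (hne : ∑ x, tripleSign a b c x ≠ 0)
    {c' : Finset (Fin 15)} (hc' : c' ∈ B) (hne' : ∑ x, tripleSign a b c' x ≠ 0) (hcc' : c ≠ c')
    {x : Option (Fin 15)} (hx : normalizedSign a b c x = -1) : normalizedSign a b c' x ≠ -1 := by
  have h0 : ∑ x, normalizedSign a b c x * normalizedSign a b c' x = 0 := by
    have h (x : Option (Fin 15)) : normalizedSign a b c x * normalizedSign a b c' x =
        correlationSign a b c * correlationSign a b c' * (blockSign c x * blockSign c' x) := by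
      rw [normalizedSign, normalizedSign, tripleSign, tripleSign]
      rcases blockSign_eq_or a x with h' | h' <;> rcases blockSign_eq_or b x with h'' | h'' <;>
        rw [h', h''] <;> ring
    rw [Finset.sum_congr rfl fun x _ => h x, ← Finset.mul_sum, hD.sum_sign_mul hc hc' hcc',
      mul_zero]
  have h1 : ∑ x, (1 - normalizedSign a b c x) * (1 - normalizedSign a b c' x) = 0 := by
    have h (x : Option (Fin 15)) : (1 - normalizedSign a b c x) * (1 - normalizedSign a b c' x) =
        1 - normalizedSign a b c x - normalizedSign a b c' x +
          normalizedSign a b c x * normalizedSign a b c' x := by ring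
    rw [Finset.sum_congr rfl fun x _ => h x, Finset.sum_add_distrib, Finset.sum_sub_distrib,
      Finset.sum_sub_distrib, h0, hD.sum_normalizedSign ha hb hab hsd hc hne,
      hD.sum_normalizedSign ha hb hab hsd hc' hne', Finset.sum_const, Finset.card_univ,
      Fintype.card_option, Fintype.card_fin]
    norm_num
  have h2 := (Finset.sum_eq_zero_iff_of_nonneg fun x _ => by
    rcases normalizedSign_eq_or a b c x with h | h <;>
      rcases normalizedSign_eq_or a b c' x with h' | h' <;> rw [h, h'] <;> norm_num).1 h1 x
      (Finset.mem_univ x)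
  intro h
  rw [hx, h] at h2
  norm_num at h2

/-- Coordinates in which two blocks whose symmetric difference is not a block, together with the
four blocks correlated to it, take a standard form. -/
lemma exists_coordinates (hD : IsDesign B) (ha : a ∈ B) (hb : b ∈ B) (hab : a ≠ b)
    (hsd : symmDiff a b ∉ B) :
    ∃ (c : Fin 4 → Finset (Fin 15)) (Φ : Fin 4 × Fin 4 ≃ Option (Fin 15)),
      (∀ r ∈ B, (∀ j, r ≠ c j) → ∑ x, tripleSign a b r x = 0) ∧ (∀ j, c j ∈ B) ∧
      (∀ y, blockSign a (Φ y) = firstSign y.1) ∧ (∀ y, blockSign b (Φ y) = secondSign y.1) ∧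
      ∀ j y, normalizedSign a b (c j) (Φ y) = if y.2 = j then -1 else 1 := by
  set D := B.filter fun c => ∑ x, tripleSign a b c x ≠ 0 with hDdef
  have hDcard : D.card = 4 := hD.card_filter_sum_tripleSign_ne_zero ha hb hab hsd
  have hmem (c : D) : c.1 ∈ B ∧ ∑ x, tripleSign a b c.1 x ≠ 0 := Finset.mem_filter.1 c.2
  let e : Fin 4 ≃ D := (D.equivFinOfCardEq hDcard).symm
  have hex (y : Fin 4 × Fin 4) : ∃ x, blockSign a x = firstSign y.1 ∧
      blockSign b x = secondSign y.1 ∧ normalizedSign a b (e y.2).1 x = -1 := by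
    obtain ⟨x, hx⟩ := Finset.card_eq_one.1 (hD.card_filter_quadrant ha hb hab hsd
      (hmem (e y.2)).1 (hmem (e y.2)).2 (firstSign_eq_or y.1) (secondSign_eq_or y.1))
    have hx' := Finset.mem_filter.1 (hx ▸ Finset.mem_singleton_self x)
    have hx'' := Finset.mem_filter.1 hx'.1
    exact ⟨x, hx''.2.1, hx''.2.2, hx'.2⟩
  choose Φ hΦa hΦb hΦ using hex
  have hother (j : Fin 4) (y : Fin 4 × Fin 4) (h : y.2 ≠ j) :
      normalizedSign a b (e j).1 (Φ y) ≠ -1 :=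
    hD.normalizedSign_ne_neg_one_of_ne ha hb hab hsd (hmem (e y.2)).1 (hmem (e y.2)).2
      (hmem (e j)).1 (hmem (e j)).2 (fun h' => h (e.injective (Subtype.ext h'))) (hΦ y)
  have hinj : Function.Injective Φ := by
    intro y z h
    refine Prod.ext (eq_of_firstSign_secondSign _ _ ?_ ?_) ?_
    · rw [← hΦa, ← hΦa, h]
    · rw [← hΦb, ← hΦb, h]
    · by_contra hne
      exact hother z.2 y hne (h ▸ hΦ z)
  have hbij : Function.Bijective Φ :=
    (Fintype.bijective_iff_injective_and_card Φ).2 ⟨hinj, by simp⟩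
  refine ⟨fun j => (e j).1, Equiv.ofBijective Φ hbij, fun r hr hrc => ?_, fun j => (hmem _).1,
    hΦa, hΦb, fun j y => ?_⟩
  · by_contra h
    refine hrc (e.symm ⟨r, Finset.mem_filter.2 ⟨hr, h⟩⟩) ?_
    change r = (e _).1
    rw [Equiv.apply_symm_apply]
  · change normalizedSign a b (e j).1 (Φ y) = _
    split_ifs with h
    · exact h ▸ hΦ y
    · exact (normalizedSign_eq_or _ _ _ _).resolve_right (hother j y h)

/-- Coordinates as in `IsDesign.exists_coordinates` in which the additional point is the origin. -/
lemma exists_pointed_coordinates (hD : IsDesign B) (ha : a ∈ B) (hb : b ∈ B) (hab : a ≠ b)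
    (hsd : symmDiff a b ∉ B) :
    ∃ (c : Fin 4 → Finset (Fin 15)) (Φ : Fin 4 × Fin 4 ≃ Option (Fin 15)), Φ (0, 0) = none ∧
      (∀ r ∈ B, (∀ j, r ≠ c j) → ∑ x, tripleSign a b r x = 0) ∧ (∀ j, c j ∈ B) ∧
      (∀ y, blockSign a (Φ y) = firstSign y.1) ∧ (∀ y, blockSign b (Φ y) = secondSign y.1) ∧
      ∀ j y, blockSign (c j) (Φ y) = (if j = 0 then -1 else 1) *
        (firstSign y.1 * secondSign y.1) * if y.2 = j then -1 else 1 := by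
  obtain ⟨c, Φ, hrest, hcB, hΦa, hΦb, hΦ⟩ := hD.exists_coordinates ha hb hab hsd
  obtain ⟨⟨k, i⟩, hki⟩ := Φ.surjective none
  have hk : k = 0 := by
    refine eq_of_firstSign_secondSign _ _ ?_ ?_
    · rw [← hΦa (k, i), hki]
      rfl
    · rw [← hΦb (k, i), hki]
      rfl
  subst hk
  have hcorr (j : Fin 4) : correlationSign a b (c j) = if j = i then -1 else 1 := by
    have h := blockSign_eq_mul_normalizedSign a b (c j) (Φ (0, i))
    rw [hΦ, hki, blockSign_none, blockSign_none, blockSign_none] at h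
    rcases eq_or_ne i j with rfl | hij
    · rw [if_pos rfl] at h ⊢
      linarith
    · rw [if_neg hij] at h
      rw [if_neg hij.symm]
      linarith
  refine ⟨c ∘ Equiv.swap 0 i, (Equiv.prodCongr (Equiv.refl _) (Equiv.swap 0 i)).trans Φ, ?_,
    fun r hr h => hrest r hr fun j => ?_, fun j => hcB _, fun y => hΦa _, fun y => hΦb _,
    fun j y => ?_⟩
  · simp [hki]
  · simpa using h (Equiv.swap 0 i j)
  · rw [Function.comp_apply, blockSign_eq_mul_normalizedSign a b, Equiv.trans_apply, hΦ, hΦa, hΦb,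
      hcorr, Equiv.prodCongr_apply, Prod.map_fst, Prod.map_snd]
    have h0 : Equiv.swap 0 i j = i ↔ j = 0 := by
      rw [Equiv.swap_apply_eq_iff, Equiv.swap_apply_right]
    simp only [h0, Equiv.refl_apply, EmbeddingLike.apply_eq_iff_eq]

end IsDesign

/-- The sign encoded by a truth value. -/
def boolSign (x : Bool) : ℤ := bif x then -1 else 1

set_option maxRecDepth 100000 in
lemma exists_candidateMask_of_sums : ∀ x0 x1 x2 : Bool,
    1 + boolSign x0 + boolSign x1 + boolSign x2 = 0 → ∀ x3 x4 x5 x6 : Bool,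
    boolSign x3 + boolSign x4 + boolSign x5 + boolSign x6 = 0 → ∀ x7 x8 x9 x10 : Bool,
    boolSign x7 + boolSign x8 + boolSign x9 + boolSign x10 = 0 → ∀ x11 x12 x13 x14 : Bool,
    boolSign x11 + boolSign x12 + boolSign x13 + boolSign x14 = 0 →
    1 - boolSign x3 - boolSign x7 + boolSign x11 = 0 →
    boolSign x0 - boolSign x4 - boolSign x8 + boolSign x12 = 0 →
    boolSign x1 - boolSign x5 - boolSign x9 + boolSign x13 = 0 →
    boolSign x2 - boolSign x6 - boolSign x10 + boolSign x14 = 0 →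
    ∃ m ∈ candidateMasks, ∀ p : Fin 15, m.testBit p =
      ![x0, x1, x2, x3, x4, x5, x6, x7, x8, x9, x10, x11, x12, x13, x14] p := by
  decide +kernel

/-- The standard enumeration of a four by four grid, starting at the additional point. -/
def gridEquiv : Fin 4 × Fin 4 ≃ Option (Fin 15) :=
  finProdFinEquiv.trans (finSuccEquiv 15)

lemma gridEquiv_zero : gridEquiv (0, 0) = none := by decide

lemma exists_perm_of_equiv (Φ : Fin 4 × Fin 4 ≃ Option (Fin 15)) (h0 : Φ (0, 0) = none) :
    ∃ τ : Equiv.Perm (Fin 15), ∀ p, some (τ p) = Φ (gridEquiv.symm (some p)) := by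
  refine ⟨Equiv.removeNone (gridEquiv.symm.trans Φ), fun p => ?_⟩
  refine Equiv.removeNone_some _ (Option.ne_none_iff_exists'.1 fun h => ?_)
  have h' : gridEquiv.symm (some p) = (0, 0) := Φ.injective (h.trans h0.symm)
  rw [Equiv.symm_apply_eq, gridEquiv_zero] at h'
  exact absurd h' (Option.some_ne_none p)

lemma mem_image_inv_iff (τ : Equiv.Perm (Fin 15)) (b : Finset (Fin 15)) (p : Fin 15) :
    p ∈ b.image ⇑τ⁻¹ ↔ blockSign b (some (τ p)) = -1 := by
  rw [blockSign_some_eq_neg_one, Finset.mem_image]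
  exact ⟨fun ⟨q, hq, h⟩ => by rwa [← h, ← Equiv.Perm.mul_apply, mul_inv_cancel],
    fun h => ⟨_, h, by rw [← Equiv.Perm.mul_apply, inv_mul_cancel, Equiv.Perm.one_apply]⟩⟩

lemma boolSign_decide (r : Finset (Fin 15)) (p : Fin 15) :
    boolSign (decide (p ∈ r)) = blockSign r (some p) := by
  by_cases h : p ∈ r <;> simp [boolSign, blockSign, h]

lemma sum_grid (Φ : Fin 4 × Fin 4 ≃ Option (Fin 15)) (f : Option (Fin 15) → ℤ) :
    ∑ x, f x = ∑ k, (f (Φ (k, 0)) + f (Φ (k, 1)) + f (Φ (k, 2)) + f (Φ (k, 3))) := by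
  rw [← Equiv.sum_comp Φ, Fintype.sum_prod_type]
  exact Finset.sum_congr rfl fun k _ => Fin.sum_univ_four _

lemma isDesign_relabel (σ : Equiv.Perm (Fin 15)) {B : Finset (Finset (Fin 15))}
    (hD : IsDesign B) : IsDesign (relabel σ B) := by
  refine ⟨(card_relabel σ B).trans hD.1, ?_, ?_⟩
  · intro b hb
    obtain ⟨d, hd, rfl⟩ := Finset.mem_image.1 hb
    rw [Finset.card_image_of_injective _ σ.injective, hD.2.1 d hd]
  · intro b hb b' hb' hne
    obtain ⟨d, hd, rfl⟩ := Finset.mem_image.1 hb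
    obtain ⟨d', hd', rfl⟩ := Finset.mem_image.1 hb'
    rw [← Finset.image_inter _ _ σ.injective, Finset.card_image_of_injective _ σ.injective]
    exact hD.2.2 d hd d' hd' fun h => hne (by rw [h])

lemma IsCenter.of_relabel {σ : Equiv.Perm (Fin 15)} {B : Finset (Finset (Fin 15))}
    {O : Finset (Fin 15)} (h : IsCenter (relabel σ B) O) : ∃ O', IsCenter B O' := by
  obtain ⟨hO, h⟩ := h
  obtain ⟨P, hP, rfl⟩ := Finset.mem_image.1 hO
  have hinj := Finset.image_injective σ.injective
  refine ⟨P, hP, fun b hb hne => ?_⟩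
  have h' := h _ (Finset.mem_image_of_mem _ hb) fun h => hne (hinj h)
  rw [← Finset.image_symmDiff _ _ σ.injective] at h'
  obtain ⟨c, hc, hc'⟩ := Finset.mem_image.1 h'
  exact hinj hc' ▸ hc

lemma exists_symmDiff_notMem {B : Finset (Finset (Fin 15))} (hD : IsDesign B)
    (hNC : ∀ O, ¬ IsCenter B O) : ∃ a ∈ B, ∃ b ∈ B, a ≠ b ∧ symmDiff a b ∉ B := by
  obtain ⟨a, ha⟩ := Finset.card_pos.1 (by rw [hD.1]; norm_num : 0 < B.card)
  by_contra! h
  exact hNC a ⟨ha, fun b hb hba => h a ha b hb hba.symm⟩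

/-- Every design without center points can be relabelled so that it contains the standard blocks
and every further block is one of the candidates. -/
lemma exists_relabel_normalForm {B : Finset (Finset (Fin 15))} (hD : IsDesign B)
    (hNC : ∀ O, ¬ IsCenter B O) : ∃ σ : Equiv.Perm (Fin 15),
      (∀ m ∈ baseMasks, pointsOfMask m ∈ relabel σ B) ∧
      ∀ b ∈ relabel σ B, ∃ m ∈ baseMasks ++ candidateMasks, b = pointsOfMask m := by
  obtain ⟨a, ha, b, hb, hab, hsd⟩ := exists_symmDiff_notMem hD hNC
  obtain ⟨c, Φ, h0, hrest, hcB, hΦa, hΦb, hΦc⟩ := hD.exists_pointed_coordinates ha hb hab hsd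
  obtain ⟨τ, hτ⟩ := exists_perm_of_equiv Φ h0
  have hia : a.image ⇑τ⁻¹ = pointsOfMask 32640 := by
    ext p
    rw [mem_image_inv_iff, hτ, hΦa, mem_pointsOfMask]
    revert p
    decide +kernel
  have hib : b.image ⇑τ⁻¹ = pointsOfMask 30840 := by
    ext p
    rw [mem_image_inv_iff, hτ, hΦb, mem_pointsOfMask]
    revert p
    decide +kernel
  have hic (j : Fin 4) : (c j).image ⇑τ⁻¹ = pointsOfMask (![28815, 5865, 9690, 17340] j) := by
    ext p
    rw [mem_image_inv_iff, hτ, hΦc, mem_pointsOfMask]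
    revert p j
    decide +kernel
  refine ⟨τ⁻¹, ?_, ?_⟩
  · have hmem {d : Finset (Fin 15)} (hd : d ∈ B) : d.image ⇑τ⁻¹ ∈ relabel τ⁻¹ B :=
      Finset.mem_image_of_mem _ hd
    simp only [baseMasks, List.forall_mem_cons]
    exact ⟨hia ▸ hmem ha, hib ▸ hmem hb, hic 0 ▸ hmem (hcB 0), hic 1 ▸ hmem (hcB 1),
      hic 2 ▸ hmem (hcB 2), hic 3 ▸ hmem (hcB 3), fun _ h => absurd h List.not_mem_nil⟩
  · intro d hd
    obtain ⟨r, hr, rfl⟩ := Finset.mem_image.1 hd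
    rcases eq_or_ne r a with rfl | hra
    · exact ⟨32640, by decide, hia⟩
    rcases eq_or_ne r b with rfl | hrb
    · exact ⟨30840, by decide, hib⟩
    by_cases hrc : ∃ j, r = c j
    · obtain ⟨j, rfl⟩ := hrc
      have hj : ∀ j : Fin 4, ![28815, 5865, 9690, 17340] j ∈ baseMasks ++ candidateMasks := by
        decide
      exact ⟨_, hj j, hic j⟩
    have hrc' (j : Fin 4) : r ≠ c j := fun h => hrc ⟨j, h⟩
    have hz := hD.sum_sign hr
    have hza := hD.sum_sign_mul hr ha hra
    have hzb := hD.sum_sign_mul hr hb hrb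
    have hzab := hrest r hr hrc'
    have hzc (j : Fin 4) := hD.sum_sign_mul hr (hcB j) (hrc' j)
    simp only [tripleSign] at hzab
    rw [sum_grid Φ] at hz hza hzb hzab
    simp only [sum_grid Φ] at hzc
    simp only [hΦa, hΦb, hΦc] at hza hzb hzab hzc
    have hzc0 := hzc 0
    have hzc1 := hzc 1
    have hzc2 := hzc 2
    have hzc3 := hzc 3
    simp [Fin.sum_univ_four, firstSign, secondSign, h0, blockSign_none]
      at hz hza hzb hzab hzc0 hzc1 hzc2 hzc3
    have hx (p : Fin 15) : boolSign (decide (τ p ∈ r)) =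
        blockSign r (Φ (gridEquiv.symm (some p))) := by
      rw [boolSign_decide, hτ]
    have hgrid : gridEquiv.symm (some 0) = (0, 1) ∧ gridEquiv.symm (some 1) = (0, 2) ∧
        gridEquiv.symm (some 2) = (0, 3) ∧ gridEquiv.symm (some 3) = (1, 0) ∧
        gridEquiv.symm (some 4) = (1, 1) ∧ gridEquiv.symm (some 5) = (1, 2) ∧
        gridEquiv.symm (some 6) = (1, 3) ∧ gridEquiv.symm (some 7) = (2, 0) ∧
        gridEquiv.symm (some 8) = (2, 1) ∧ gridEquiv.symm (some 9) = (2, 2) ∧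
        gridEquiv.symm (some 10) = (2, 3) ∧ gridEquiv.symm (some 11) = (3, 0) ∧
        gridEquiv.symm (some 12) = (3, 1) ∧ gridEquiv.symm (some 13) = (3, 2) ∧
        gridEquiv.symm (some 14) = (3, 3) := by decide
    obtain ⟨g0, g1, g2, g3, g4, g5, g6, g7, g8, g9, g10, g11, g12, g13, g14⟩ := hgrid
    obtain ⟨m, hm, hmp⟩ := exists_candidateMask_of_sums (decide (τ 0 ∈ r)) (decide (τ 1 ∈ r))
      (decide (τ 2 ∈ r)) (by rw [hx, hx, hx, g0, g1, g2]; linarith)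
      (decide (τ 3 ∈ r)) (decide (τ 4 ∈ r)) (decide (τ 5 ∈ r)) (decide (τ 6 ∈ r))
      (by rw [hx, hx, hx, hx, g3, g4, g5, g6]; linarith)
      (decide (τ 7 ∈ r)) (decide (τ 8 ∈ r)) (decide (τ 9 ∈ r)) (decide (τ 10 ∈ r))
      (by rw [hx, hx, hx, hx, g7, g8, g9, g10]; linarith)
      (decide (τ 11 ∈ r)) (decide (τ 12 ∈ r)) (decide (τ 13 ∈ r)) (decide (τ 14 ∈ r))
      (by rw [hx, hx, hx, hx, g11, g12, g13, g14]; linarith)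
      (by rw [hx, hx, hx, g3, g7, g11]; linarith)
      (by rw [hx, hx, hx, hx, g0, g4, g8, g12]; linarith)
      (by rw [hx, hx, hx, hx, g1, g5, g9, g13]; linarith)
      (by rw [hx, hx, hx, hx, g2, g6, g10, g14]; linarith)
    refine ⟨m, List.mem_append_right _ hm, ?_⟩
    ext p
    have hp : m.testBit p = decide (τ p ∈ r) := by
      rw [hmp]
      fin_cases p <;> rfl
    rw [mem_image_inv_iff, blockSign_some_eq_neg_one, mem_pointsOfMask, hp, decide_eq_true_iff]

lemma isSplitByFrobenius_of_not_isCenter {B : Finset (Finset (Fin 15))} (hD : IsDesign B)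
    (hNC : ∀ O, ¬ IsCenter B O) : IsSplitByFrobenius (designAut B) := by
  obtain ⟨σ, hbase, hB⟩ := exists_relabel_normalForm hD hNC
  refine (isSplitByFrobenius_of_normalForm (isDesign_relabel σ hD) (fun O hO => ?_) hbase
    hB).of_mulEquiv (designAutRelabel σ B)
  obtain ⟨O', hO'⟩ := hO.of_relabel
  exact hNC O' hO'

/-- for a design of type (NC) (no center point), `Aut(𝒟)` is a semidirect
product of a normal subgroup isomorphic to `(ZMod 2)³` and a subgroup isomorphic to the
Frobenius group `C₇ ⋊ C₃` of order 21 (the unique nonabelian group of order 21). -/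
theorem stmt4 (B : Finset (Finset (Fin 15))) (hD : IsDesign B)
    (hNC : ∀ O, ¬ IsCenter B O) :
    ∃ N H : Subgroup ↥(designAut B),
      N.Normal ∧
      Nonempty (↥N ≃* Multiplicative (ZMod 2 × ZMod 2 × ZMod 2)) ∧
      (Nat.card ↥H = 21 ∧ ¬ (∀ a b : ↥H, a * b = b * a)) ∧
      N ⊓ H = ⊥ ∧
      (∀ g : ↥(designAut B), ∃ n ∈ N, ∃ h ∈ H, g = n * h) := by
  exact isSplitByFrobenius_of_not_isCenter hD hNC
end

section
/- Let δ be a permutation of the Fano plane F with ind(δ) = 0. Then G_δ is isomorphic to the Frobenius group C₇ ⋊ C₃ of order 21 (the unique nonabelian group of order 21), and G_δ is a maximal proper subgroup of the full automorphism group of F. -/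
/-- The Fano plane: the 7 nonzero vectors of `(ZMod 2)³`. -/
abbrev FanoPoint : Type := {v : Fin 3 → ZMod 2 // v ≠ 0}

/-- A line of the Fano plane: a set `{x, y, x + y}` with `x ≠ y` nonzero. -/
def IsFanoLine (L : Set FanoPoint) : Prop :=
  ∃ x y : FanoPoint, x ≠ y ∧
    L = {z : FanoPoint | z.1 = x.1 ∨ z.1 = y.1 ∨ z.1 = x.1 + y.1}

/-- An automorphism of the Fano plane: a bijection mapping every line to a line. -/
def IsFanoAut (f : Equiv.Perm FanoPoint) : Prop :=
  ∀ L : Set FanoPoint, IsFanoLine L → IsFanoLine (⇑f '' L)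

/-- A `δ`-line: the preimage under `δ` of a line. -/
def IsDeltaLine (δ : Equiv.Perm FanoPoint) (S : Set FanoPoint) : Prop :=
  ∃ L : Set FanoPoint, IsFanoLine L ∧ S = ⇑δ ⁻¹' L

private lemma preserved_inv {P : Set FanoPoint → Prop} {f : Equiv.Perm FanoPoint}
    (h : ∀ S, P S → P (⇑f '' S)) : ∀ S, P S → P (⇑f⁻¹ '' S) := by
  intro S hS
  obtain ⟨S', hS', hEq⟩ := exists_preimage' (F := fun T => ⇑f '' T)
    (Set.image_injective.mpr f.injective) h hS
  rw [← hEq, Set.image_image]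
  have : (fun x => f⁻¹ (f x)) = fun x : FanoPoint => x := by
    funext x; simp
  rw [this, Set.image_id']
  exact hS'

/-- The full automorphism group of the Fano plane. -/
def fanoAutGroup : Subgroup (Equiv.Perm FanoPoint) where
  carrier := {f | IsFanoAut f}
  one_mem' := by intro L hL; simpa using hL
  mul_mem' := by
    intro a b ha hb L hL
    rw [Equiv.Perm.coe_mul, Set.image_comp]
    exact ha _ (hb L hL)
  inv_mem' := by
    intro f hf
    exact preserved_inv hf

/-- `G_δ`: the group of automorphisms of the Fano plane mapping every `δ`-line to a
`δ`-line. -/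
def Gdelta (δ : Equiv.Perm FanoPoint) : Subgroup (Equiv.Perm FanoPoint) where
  carrier := {f | IsFanoAut f ∧ ∀ S, IsDeltaLine δ S → IsDeltaLine δ (⇑f '' S)}
  one_mem' := by
    constructor
    · intro L hL; simpa using hL
    · intro S hS; simpa using hS
  mul_mem' := by
    rintro a b ⟨ha1, ha2⟩ ⟨hb1, hb2⟩
    constructor
    · intro L hL
      rw [Equiv.Perm.coe_mul, Set.image_comp]
      exact ha1 _ (hb1 L hL)
    · intro S hS
      rw [Equiv.Perm.coe_mul, Set.image_comp]
      exact ha2 _ (hb2 S hS)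
  inv_mem' := by
    rintro f ⟨h1, h2⟩
    exact ⟨preserved_inv h1, preserved_inv h2⟩

/-- `ind(δ)`: the number of lines `L` such that `δ(L)` is a line. -/
noncomputable def fanoIndex (δ : Equiv.Perm FanoPoint) : ℕ :=
  {L : Set FanoPoint | IsFanoLine L ∧ IsFanoLine (⇑δ '' L)}.ncard

namespace FanoModel

/-- The third point on the line through two points of `ℤ/7`, for the lines `{i, i + 1, i + 3}`. -/
def third (x y : Fin 7) : Fin 7 :=
  4 * (x + y) - (y - x) * (y - x) * ((y - x) * (y - x))

/-- The endomorphism condition for the cyclic Fano plane on `ℤ/7`. -/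
abbrev IsHom (f : Fin 7 → Fin 7) : Prop := ∀ x y, f (third x y) = third (f x) (f y)

/-- The map commuting with `third` that sends `0, 1, 2` to `a, b, c`. -/
def extend (a b c : Fin 7) : Fin 7 → Fin 7 :=
  ![a, b, c, third a b, third b c, third c (third a b), third (third a b) (third b c)]

/-- Three points forming a triangle. -/
abbrev Triangle (a b c : Fin 7) : Prop := a ≠ b ∧ c ≠ a ∧ c ≠ b ∧ c ≠ third a b

lemma extend_of_isHom {f : Fin 7 → Fin 7} (hf : IsHom f) : f = extend (f 0) (f 1) (f 2) := by
  have h3 : f 3 = third (f 0) (f 1) := hf 0 1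
  have h4 : f 4 = third (f 1) (f 2) := hf 1 2
  have h5 : f 5 = third (f 2) (f 3) := hf 2 3
  have h6 : f 6 = third (f 3) (f 4) := hf 3 4
  funext x
  fin_cases x
  · rfl
  · rfl
  · rfl
  · exact h3
  · exact h4
  · exact h5.trans (by rw [h3]; rfl)
  · exact h6.trans (by rw [h3, h4]; rfl)

lemma triangle_of_injective {f : Fin 7 → Fin 7} (hf : IsHom f) (hi : Function.Injective f) :
    Triangle (f 0) (f 1) (f 2) := by
  refine ⟨hi.ne (by decide), hi.ne (by decide), hi.ne (by decide), ?_⟩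
  rw [← hf 0 1]
  exact hi.ne (by decide)

lemma third_self : ∀ x : Fin 7, third x x = x := by
  decide +kernel

lemma third_comm : ∀ x y : Fin 7, third x y = third y x := by
  decide +kernel

lemma extend_of_lt : ∀ a b c, Triangle a b c → ∀ x y, x < y →
    extend a b c (third x y) = third (extend a b c x) (extend a b c y) ∧
      extend a b c x ≠ extend a b c y := by
  decide +kernel

lemma isHom_extend {a b c : Fin 7} (h : Triangle a b c) : IsHom (extend a b c) := by
  intro x y
  obtain hxy | rfl | hxy := lt_trichotomy x y
  · exact (extend_of_lt a b c h x y hxy).1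
  · simp only [third_self]
  · rw [third_comm x y, third_comm (extend a b c x)]
    exact (extend_of_lt a b c h y x hxy).1

lemma extend_injective {a b c : Fin 7} (h : Triangle a b c) :
    Function.Injective (extend a b c) := by
  intro x y hf
  obtain hxy | hxy | hxy := lt_trichotomy x y
  · exact absurd hf (extend_of_lt a b c h x y hxy).2
  · exact hxy
  · exact absurd hf.symm (extend_of_lt a b c h y x hxy).2

/-- The automorphism group of the cyclic Fano plane. -/
def autGroup : Subgroup (Equiv.Perm (Fin 7)) where
  carrier := {f | IsHom f}
  one_mem' := fun _ _ => rfl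
  mul_mem' := by
    intro f g hf hg x y
    rw [Equiv.Perm.mul_apply, hg x y, hf]
    rfl
  inv_mem' := by
    intro f hf x y
    rw [Equiv.Perm.inv_eq_iff_eq, hf]
    simp

lemma mem_autGroup {f : Equiv.Perm (Fin 7)} : f ∈ autGroup ↔ IsHom f := Iff.rfl

/-- The automorphism sending `0, 1, 2` to a given triangle. -/
lemma exists_autGroup_of_triangle {a b c : Fin 7} (h : Triangle a b c) :
    ∃ f ∈ autGroup, ⇑f = extend a b c :=
  ⟨Equiv.ofBijective _ (Finite.injective_iff_bijective.mp (extend_injective h)),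
    isHom_extend h, rfl⟩

/-- Negation on `ℤ/7`, which maps the cyclic Fano plane to a disjoint one. -/
def negPerm : Equiv.Perm (Fin 7) := Equiv.neg (Fin 7)

/-- The common automorphisms of the cyclic Fano plane and its negative. -/
def frobGroup : Subgroup (Equiv.Perm (Fin 7)) :=
  autGroup ⊓ autGroup.comap (MulAut.conj negPerm).toMonoidHom

lemma mem_frobGroup {f : Equiv.Perm (Fin 7)} :
    f ∈ frobGroup ↔ f ∈ autGroup ∧ negPerm * f * negPerm⁻¹ ∈ autGroup := Iff.rfl

/-- The nonzero squares modulo `7`. -/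
abbrev IsMult (u : Fin 7) : Prop := u = 1 ∨ u = 2 ∨ u = 4

lemma affine_isHom : ∀ u v, IsMult u → IsHom (fun x => u * x + v) ∧
    IsHom (fun x => -(u * (-x) + v)) ∧ ∀ x y : Fin 7, u * x + v = u * y + v → x = y := by
  decide +kernel

lemma mem_frobGroup_of_affine {f : Equiv.Perm (Fin 7)} {u v : Fin 7} (hu : IsMult u)
    (hf : ∀ x, f x = u * x + v) : f ∈ frobGroup := by
  obtain ⟨h1, h2, -⟩ := affine_isHom u v hu
  refine mem_frobGroup.mpr ⟨?_, ?_⟩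
  · intro x y
    simp only [hf]
    exact h1 x y
  · intro x y
    have key : ∀ z, (negPerm * f * negPerm⁻¹) z = -(u * (-z) + v) := by
      intro z
      rw [← hf]
      rfl
    simp only [key]
    exact h2 x y

lemma exists_affine {u v : Fin 7} (hu : IsMult u) :
    ∃ f ∈ frobGroup, ∀ x, f x = u * x + v := by
  let f := Equiv.ofBijective (fun x => u * x + v)
    (Finite.injective_iff_bijective.mp fun x y => (affine_isHom u v hu).2.2 x y)
  exact ⟨f, mem_frobGroup_of_affine hu fun _ => rfl, fun _ => rfl⟩

lemma extend_affine : ∀ a b c, Triangle a b c →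
    extend a b c 5 = -third (-a) (-b) → extend a b c 3 = -third (-a) (-c) →
      IsMult (b - a) ∧ ∀ x, extend a b c x = (b - a) * x + a := by
  decide +kernel

lemma exists_affine_of_mem {f : Equiv.Perm (Fin 7)} (hf : f ∈ frobGroup) :
    IsMult (f 1 - f 0) ∧ ∀ x, f x = (f 1 - f 0) * x + f 0 := by
  obtain ⟨h1, h2⟩ := mem_frobGroup.mp hf
  have h5 : f 5 = -third (-f 0) (-f 1) := by
    have h : -f 5 = third (-f 0) (-f 1) := h2 0 6
    rw [← h, neg_neg]
  have h3 : f 3 = -third (-f 0) (-f 2) := by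
    have h : -f 3 = third (-f 0) (-f 2) := h2 0 5
    rw [← h, neg_neg]
  rw [extend_of_isHom h1] at h5 h3
  have h := extend_affine _ _ _ (triangle_of_injective h1 f.injective) h5 h3
  rwa [← extend_of_isHom h1] at h

lemma card_frobGroup : Nat.card frobGroup = 21 := by
  let F : frobGroup → {p : Fin 7 × Fin 7 // IsMult p.1} := fun f =>
    ⟨(f.1 1 - f.1 0, f.1 0), (exists_affine_of_mem f.2).1⟩
  have hF : Function.Bijective F := by
    constructor
    · intro f g h
      have h' := congrArg Subtype.val h
      have h1 : f.1 1 - f.1 0 = g.1 1 - g.1 0 := congrArg Prod.fst h'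
      have h2 : f.1 0 = g.1 0 := congrArg Prod.snd h'
      ext x : 2
      rw [(exists_affine_of_mem f.2).2 x, (exists_affine_of_mem g.2).2 x, h1, h2]
    · rintro ⟨⟨u, v⟩, hu⟩
      obtain ⟨f, hf, h⟩ := exists_affine (v := v) hu
      refine ⟨⟨f, hf⟩, Subtype.ext ?_⟩
      have aux : ∀ u v : Fin 7, (u * 1 + v - (u * 0 + v), u * 0 + v) = (u, v) := by decide
      simp only [F, h]
      exact aux u v
  rw [Nat.card_eq_of_bijective F hF, Nat.card_eq_fintype_card]
  decide +kernel

lemma exists_translation (k : Fin 7) : ∃ f ∈ frobGroup, ∀ x, f x = x + k := by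
  obtain ⟨f, hf, h⟩ := exists_affine (u := 1) (v := k) (by decide)
  refine ⟨f, hf, fun x => ?_⟩
  rw [h, one_mul]

lemma frobGroup_not_comm : ∃ f ∈ frobGroup, ∃ g ∈ frobGroup, f * g ≠ g * f := by
  obtain ⟨f, hf, hf'⟩ := exists_affine (u := 1) (v := 1) (by decide)
  obtain ⟨g, hg, hg'⟩ := exists_affine (u := 2) (v := 0) (by decide)
  refine ⟨f, hf, g, hg, fun h => ?_⟩
  have h0 := congrArg (fun p : Equiv.Perm (Fin 7) => p 0) h
  simp only [Equiv.Perm.mul_apply, hf', hg'] at h0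
  revert h0
  decide

lemma frobGroup_le : frobGroup ≤ autGroup := inf_le_left

lemma frobGroup_lt : frobGroup < autGroup := by
  refine lt_of_le_of_ne frobGroup_le fun h => ?_
  obtain ⟨f, hf, hf'⟩ := exists_autGroup_of_triangle (a := 0) (b := 1) (c := 4) (by decide)
  have h2 := (exists_affine_of_mem (h ▸ hf)).2 2
  rw [hf'] at h2
  revert h2
  decide

lemma card_autGroup_le : Nat.card autGroup ≤ 168 := by
  let F : autGroup → {p : Fin 7 × Fin 7 × Fin 7 // Triangle p.1 p.2.1 p.2.2} := fun f =>
    ⟨(f.1 0, f.1 1, f.1 2), triangle_of_injective f.2 f.1.injective⟩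
  have hF : Function.Injective F := by
    intro f g h
    have h' := congrArg Subtype.val h
    simp only [F, Prod.mk.injEq] at h'
    refine Subtype.ext (DFunLike.coe_injective ?_)
    rw [extend_of_isHom f.2, extend_of_isHom g.2, h'.1, h'.2.1, h'.2.2]
  refine (Nat.card_le_card_of_injective F hF).trans ?_
  rw [Nat.card_eq_fintype_card]
  decide +kernel

set_option synthInstance.maxSize 1000 in
set_option synthInstance.maxHeartbeats 200000 in
lemma extend_of_conj_translation : ∀ a b c, Triangle a b c → ∀ v, v ≠ 0 →
    (∀ x, extend a b c (x + v) = extend a b c x + (extend a b c v - a)) →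
      IsMult (b - a) ∧ ∀ x, extend a b c x = (b - a) * x + a := by
  decide +kernel

lemma mult_eq_one_of_no_fixed : ∀ u v : Fin 7, IsMult u → (∀ x, u * x + v ≠ x) →
    u = 1 ∧ v ≠ 0 := by
  decide +kernel

/-- The common automorphism group is self-normalizing on translations. -/
lemma mem_frobGroup_of_conj_translation {f t : Equiv.Perm (Fin 7)} {k : Fin 7}
    (hf : f ∈ autGroup) (hk : k ≠ 0) (ht : ∀ x, t x = x + k) (h : f⁻¹ * t * f ∈ frobGroup) :
    f ∈ frobGroup := by
  obtain ⟨hu, hg⟩ := exists_affine_of_mem h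
  set u := (f⁻¹ * t * f) 1 - (f⁻¹ * t * f) 0
  set v := (f⁻¹ * t * f) 0
  have hcomm : ∀ x, f (u * x + v) = f x + k := by
    intro x
    rw [← hg, ← ht]
    simp
  obtain ⟨hu1, hv⟩ := mult_eq_one_of_no_fixed u v hu (by
    intro x hx
    have := hcomm x
    rw [hx] at this
    exact hk (left_eq_add.mp this))
  simp only [hu1, one_mul] at hcomm
  have hT := triangle_of_injective hf f.injective
  have hk' : k = f v - f 0 := by
    rw [eq_sub_iff_add_eq', ← hcomm, zero_add]
  rw [hk', extend_of_isHom hf] at hcomm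
  have := extend_of_conj_translation _ _ _ hT v hv hcomm
  rw [← extend_of_isHom hf] at this
  exact mem_frobGroup_of_affine this.1 this.2

lemma eq_autGroup_of_frobGroup_lt {K : Subgroup (Equiv.Perm (Fin 7))} (h1 : frobGroup < K)
    (h2 : K ≤ autGroup) : K = autGroup := by
  obtain ⟨hle, f, hfK, hf⟩ := SetLike.lt_iff_le_and_exists.mp h1
  choose t ht ht' using exists_translation
  let F : Fin 7 × frobGroup → K := fun p =>
    ⟨t p.1 * f * p.2.1, K.mul_mem (K.mul_mem (hle (ht _)) hfK) (hle p.2.2)⟩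
  have hF : Function.Injective F := by
    rintro ⟨i, g⟩ ⟨j, g'⟩ h
    have h : t i * f * g.1 = t j * f * g'.1 := congrArg Subtype.val h
    have hij : i = j := by
      by_contra hne
      refine hf (mem_frobGroup_of_conj_translation (t := (t j)⁻¹ * t i) (k := i - j) (h2 hfK)
        (sub_ne_zero.mpr hne) (fun x => ?_) ?_)
      · rw [Equiv.Perm.mul_apply, Equiv.Perm.inv_eq_iff_eq, ht', ht']
        abel
      · have : f⁻¹ * ((t j)⁻¹ * t i) * f = g'.1 * g.1⁻¹ := by
          rw [eq_mul_inv_iff_mul_eq]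
          calc _ = f⁻¹ * (t j)⁻¹ * (t i * f * g.1) := by group
            _ = _ := by rw [h]; group
        rw [this]
        exact frobGroup.mul_mem g'.2 (frobGroup.inv_mem g.2)
    subst hij
    exact Prod.ext rfl (Subtype.ext (mul_left_cancel h))
  have hcard : 147 ≤ Nat.card K := by
    have := Nat.card_le_card_of_injective F hF
    rwa [Nat.card_prod, card_frobGroup, Nat.card_fin] at this
  refine Subgroup.eq_of_le_of_card_ge h2 ?_
  obtain ⟨m, hm⟩ := Subgroup.card_dvd_of_le h2
  have hpos : 0 < Nat.card autGroup := Nat.card_pos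
  have := card_autGroup_le
  have hm1 : m ≤ 1 := by
    by_contra! h
    nlinarith
  nlinarith

set_option synthInstance.maxSize 1000 in
set_option synthInstance.maxHeartbeats 200000 in
lemma exists_extend_of_no_common_line : ∀ w₂ : Fin 7, w₂ ∉ [0, 1, 2] →
    ∀ w₄ ∉ [0, 1, 2, w₂], ∀ w₅ ∉ [0, 1, 2, w₂, w₄], ∀ w₆ ∉ [0, 1, 2, w₂, w₄, w₅],
    (∀ x y, x ≠ y → ![0, 1, w₂, 2, w₄, w₅, w₆] (third x y) ≠
      third (![0, 1, w₂, 2, w₄, w₅, w₆] x) (![0, 1, w₂, 2, w₄, w₅, w₆] y)) →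
    ∃ b c, Triangle 0 b c ∧ IsHom fun x => ![0, 1, w₂, 2, w₄, w₅, w₆] (extend 0 b c (-x)) := by
  decide +kernel

/-- A permutation mapping no line to a line lies in the double coset of negation. -/
lemma exists_mul_negPerm {d : Equiv.Perm (Fin 7)}
    (hd : ∀ x y, x ≠ y → d (third x y) ≠ third (d x) (d y)) :
    ∃ f ∈ autGroup, ∃ h ∈ autGroup, d = h * negPerm * f := by
  have hT : Triangle (d 0) (d 1) (d 3) :=
    ⟨d.injective.ne (by decide), d.injective.ne (by decide), d.injective.ne (by decide),
      hd 0 1 (by decide)⟩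
  obtain ⟨g, hg, hg'⟩ := exists_autGroup_of_triangle hT
  have hw : ⇑(g⁻¹ * d) = ![0, 1, (g⁻¹ * d) 2, 2, (g⁻¹ * d) 4, (g⁻¹ * d) 5, (g⁻¹ * d) 6] := by
    funext x
    fin_cases x
    · exact (Equiv.Perm.inv_eq_iff_eq).mpr (by rw [hg']; rfl)
    · exact (Equiv.Perm.inv_eq_iff_eq).mpr (by rw [hg']; rfl)
    · rfl
    · exact (Equiv.Perm.inv_eq_iff_eq).mpr (by rw [hg']; rfl)
    · rfl
    · rfl
    · rfl
  have h0 : 0 = (g⁻¹ * d) 0 := (congrFun hw 0).symm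
  have h1 : 1 = (g⁻¹ * d) 1 := (congrFun hw 1).symm
  have h3 : 2 = (g⁻¹ * d) 3 := (congrFun hw 3).symm
  have hne : ∀ {x : Fin 7} {l : List (Fin 7)}, x ∉ l → (g⁻¹ * d) x ∉ l.map (g⁻¹ * d) :=
    fun hx => by rwa [List.mem_map_of_injective (g⁻¹ * d).injective]
  obtain ⟨b, c, hbc, hom⟩ := exists_extend_of_no_common_line
    _ (by simpa only [List.map, ← h0, ← h1, ← h3] using
          hne (x := 2) (l := [0, 1, 3]) (by decide))
    _ (by simpa only [List.map, ← h0, ← h1, ← h3] using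
          hne (x := 4) (l := [0, 1, 3, 2]) (by decide))
    _ (by simpa only [List.map, ← h0, ← h1, ← h3] using
          hne (x := 5) (l := [0, 1, 3, 2, 4]) (by decide))
    _ (by simpa only [List.map, ← h0, ← h1, ← h3] using
          hne (x := 6) (l := [0, 1, 3, 2, 4, 5]) (by decide))
    (by
      rw [← hw]
      intro x y hxy h
      refine hd x y hxy ?_
      have h' := congrArg g h
      rw [mem_autGroup.mp hg] at h'
      simpa using h')
  rw [← hw] at hom
  obtain ⟨f, hf, hf'⟩ := exists_autGroup_of_triangle hbc
  rw [← hf'] at hom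
  have hm : g⁻¹ * d * f * negPerm ∈ autGroup := hom
  refine ⟨f⁻¹, inv_mem hf, g * (g⁻¹ * d * f * negPerm), mul_mem hg hm, ?_⟩
  have hn : negPerm * negPerm = 1 := by
    ext x : 1
    exact neg_neg x
  calc d = d * f * (1 : Equiv.Perm (Fin 7)) * f⁻¹ := by group
    _ = _ := by rw [← hn]; group

/-- The powers of a primitive element of the field with eight elements. -/
def pointFun (i : Fin 7) : FanoPoint :=
  ⟨![![1, 0, 0], ![0, 1, 0], ![0, 0, 1], ![1, 1, 0], ![0, 1, 1], ![1, 1, 1], ![1, 0, 1]] i, by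
    revert i
    decide⟩

/-- The identification of `ℤ/7` with the points of the Fano plane. -/
noncomputable def point : Fin 7 ≃ FanoPoint :=
  Equiv.ofBijective pointFun
    ((Fintype.bijective_iff_injective_and_card _).mpr ⟨by
      intro x y
      revert x y
      decide +kernel, by decide +kernel⟩)

lemma point_third : ∀ x y : Fin 7, x ≠ y →
    (point (third x y)).1 = (point x).1 + (point y).1 := by
  change ∀ x y : Fin 7, x ≠ y → (pointFun (third x y)).1 = (pointFun x).1 + (pointFun y).1
  decide +kernel

/-- The line of the Fano plane through two points. -/
def line (x y : Fin 7) : Set FanoPoint := point '' {x, y, third x y}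

lemma line_eq {x y : Fin 7} (h : x ≠ y) : line x y =
    {z | z.1 = (point x).1 ∨ z.1 = (point y).1 ∨ z.1 = (point x).1 + (point y).1} := by
  ext z
  rw [← point_third x y h]
  simp only [line, Set.mem_image, Set.mem_insert_iff, Set.mem_singleton_iff, exists_eq_or_imp,
    exists_eq_left, Set.mem_ofPred_eq, ← Subtype.ext_iff, eq_comm (b := z)]

lemma isFanoLine_iff {L : Set FanoPoint} :
    IsFanoLine L ↔ ∃ x y, x ≠ y ∧ L = line x y := by
  constructor
  · rintro ⟨x, y, hxy, rfl⟩
    have h : point.symm x ≠ point.symm y := point.symm.injective.ne hxy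
    exact ⟨_, _, h, by rw [line_eq h]; simp⟩
  · rintro ⟨x, y, hxy, rfl⟩
    exact ⟨point x, point y, point.injective.ne hxy, line_eq hxy⟩

lemma eq_third_of_mem : ∀ a b p q r : Fin 7, (p = a ∨ p = b ∨ p = third a b) →
    (q = a ∨ q = b ∨ q = third a b) → (r = a ∨ r = b ∨ r = third a b) →
    p ≠ q → r ≠ p → r ≠ q → r = third p q := by
  decide +kernel

lemma third_ne : ∀ x y : Fin 7, x ≠ y → third x y ≠ x ∧ third x y ≠ y := by
  decide +kernel

lemma image_line (f : Equiv.Perm (Fin 7)) (x y : Fin 7) :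
    ⇑(point.permCongrHom f) '' line x y = point '' {f x, f y, f (third x y)} := by
  simp [line, Set.image_insert_eq, Equiv.permCongrHom]

lemma isFanoLine_image_iff (f : Equiv.Perm (Fin 7)) {x y : Fin 7} (h : x ≠ y) :
    IsFanoLine (⇑(point.permCongrHom f) '' line x y) ↔ f (third x y) = third (f x) (f y) := by
  rw [image_line, isFanoLine_iff]
  constructor
  · rintro ⟨a, b, -, hL⟩
    have hL := point.injective.image_injective hL
    have mem : ∀ z ∈ ({f x, f y, f (third x y)} : Set (Fin 7)), z = a ∨ z = b ∨ z = third a b := by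
      intro z hz
      rw [hL] at hz
      simpa using hz
    exact eq_third_of_mem a b _ _ _ (mem _ (by simp)) (mem _ (by simp)) (mem _ (by simp))
      (f.injective.ne h) (f.injective.ne (third_ne x y h).1) (f.injective.ne (third_ne x y h).2)
  · intro hf
    exact ⟨f x, f y, f.injective.ne h, by rw [hf]; rfl⟩

lemma permCongrHom_mem_fanoAutGroup {f : Equiv.Perm (Fin 7)} :
    point.permCongrHom f ∈ fanoAutGroup ↔ f ∈ autGroup := by
  constructor
  · intro hf x y
    obtain rfl | h := eq_or_ne x y
    · simp only [third_self]
    · exact (isFanoLine_image_iff f h).mp (hf _ (isFanoLine_iff.mpr ⟨x, y, h, rfl⟩))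
  · intro hf L hL
    obtain ⟨x, y, h, rfl⟩ := isFanoLine_iff.mp hL
    exact (isFanoLine_image_iff f h).mpr (hf x y)

lemma mem_Gdelta_iff {δ f : Equiv.Perm FanoPoint} :
    f ∈ Gdelta δ ↔ f ∈ fanoAutGroup ∧ δ * f * δ⁻¹ ∈ fanoAutGroup := by
  have himg : ∀ L : Set FanoPoint, ⇑(δ * f * δ⁻¹) '' L = ⇑δ '' (⇑f '' (⇑δ ⁻¹' L)) := by
    intro L
    rw [Equiv.Perm.coe_mul, Equiv.Perm.coe_mul, Set.image_comp, Set.image_comp,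
      Equiv.Perm.inv_def, Equiv.image_symm_eq_preimage]
  refine and_congr Iff.rfl ⟨fun h L hL => ?_, ?_⟩
  · obtain ⟨M, hM, hM'⟩ := h _ ⟨L, hL, rfl⟩
    rwa [himg, hM', Set.image_preimage_eq _ δ.surjective]
  · rintro h S ⟨L, hL, rfl⟩
    exact ⟨_, h L hL, by rw [himg, Set.preimage_image_eq _ δ.injective]⟩

lemma ne_third_of_fanoIndex_eq_zero {d : Equiv.Perm (Fin 7)}
    (h0 : fanoIndex (point.permCongrHom d) = 0) (x y : Fin 7) (h : x ≠ y) :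
    d (third x y) ≠ third (d x) (d y) := by
  rw [fanoIndex, Set.ncard_eq_zero (Set.toFinite _)] at h0
  intro hd
  exact Set.eq_empty_iff_forall_notMem.mp h0 (line x y)
    ⟨isFanoLine_iff.mpr ⟨x, y, h, rfl⟩, (isFanoLine_image_iff d h).mpr hd⟩

/-- A permutation of index zero identifies the pair of groups with the cyclic model. -/
lemma exists_mulEquiv {δ : Equiv.Perm FanoPoint} (h0 : fanoIndex δ = 0) :
    ∃ c : Equiv.Perm (Fin 7) ≃* Equiv.Perm FanoPoint,
      fanoAutGroup = autGroup.map c.toMonoidHom ∧ Gdelta δ = frobGroup.map c.toMonoidHom := by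
  obtain ⟨d, rfl⟩ := point.permCongrHom.surjective δ
  obtain ⟨f, hf, h, hh, rfl⟩ := exists_mul_negPerm (ne_third_of_fanoIndex_eq_zero h0)
  have conj_mem : ∀ {p g : Equiv.Perm (Fin 7)}, p ∈ autGroup →
      (p * g * p⁻¹ ∈ autGroup ↔ g ∈ autGroup) := by
    intro p g hp
    rw [Subgroup.mul_mem_cancel_right _ (inv_mem hp), Subgroup.mul_mem_cancel_left _ hp]
  have key : ∀ g : Equiv.Perm (Fin 7), f⁻¹ * g * f ∈ autGroup ↔ g ∈ autGroup := by
    intro g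
    simpa using conj_mem (g := g) (inv_mem hf)
  let c := (MulAut.conj f⁻¹).trans point.permCongrHom
  have hc : ∀ g, c g = point.permCongrHom (f⁻¹ * g * f) := fun g => by simp [c]
  refine ⟨c, ?_, ?_⟩
  · ext p
    obtain ⟨g, rfl⟩ := c.surjective p
    rw [show c g = c.toMonoidHom g from rfl, Subgroup.mem_map_iff_mem c.injective, ← key,
      ← permCongrHom_mem_fanoAutGroup, ← hc]
    rfl
  · ext p
    obtain ⟨g, rfl⟩ := c.surjective p
    rw [show c g = c.toMonoidHom g from rfl, Subgroup.mem_map_iff_mem c.injective,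
      mem_frobGroup, show c.toMonoidHom g = c g from rfl, hc, mem_Gdelta_iff, ← map_inv,
      ← map_mul, ← map_mul, permCongrHom_mem_fanoAutGroup, permCongrHom_mem_fanoAutGroup, key,
      ← conj_mem (g := negPerm * g * negPerm⁻¹) hh]
    refine and_congr Iff.rfl (iff_of_eq (congrArg (· ∈ autGroup) ?_))
    group

end FanoModel

/-- if `ind(δ) = 0`, then `G_δ` is isomorphic to the Frobenius group
`C₇ ⋊ C₃` of order 21 (the unique nonabelian group of order 21) and is a maximal proper
subgroup of the full automorphism group of the Fano plane. -/
theorem stmt6 (δ : Equiv.Perm FanoPoint) (h0 : fanoIndex δ = 0) :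
    (Nat.card ↥(Gdelta δ) = 21 ∧ ¬ (∀ a b : ↥(Gdelta δ), a * b = b * a)) ∧
    Gdelta δ < fanoAutGroup ∧
    ∀ K : Subgroup (Equiv.Perm FanoPoint),
      Gdelta δ < K → K ≤ fanoAutGroup → K = fanoAutGroup := by
  obtain ⟨c, hA, hG⟩ := FanoModel.exists_mulEquiv h0
  rw [hA, hG]
  refine ⟨⟨?_, ?_⟩, ?_, ?_⟩
  · rw [Subgroup.card_map_of_injective c.injective, FanoModel.card_frobGroup]
  · intro h
    obtain ⟨f, hf, g, hg, hfg⟩ := FanoModel.frobGroup_not_comm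
    have h' := congrArg Subtype.val
      (h ⟨c f, Subgroup.mem_map_of_mem c.toMonoidHom hf⟩
        ⟨c g, Subgroup.mem_map_of_mem c.toMonoidHom hg⟩)
    simp only [Subgroup.coe_mul, ← map_mul] at h'
    exact hfg (c.injective h')
  · exact (Subgroup.map_lt_map_iff_of_injective c.injective).mpr FanoModel.frobGroup_lt
  · intro K h1 h2
    obtain ⟨K, rfl⟩ := (⟨_, Subgroup.map_comap_eq_self_of_surjective c.surjective K⟩ :
      ∃ H : Subgroup (Equiv.Perm (Fin 7)), H.map c.toMonoidHom = K)
    rw [FanoModel.eq_autGroup_of_frobGroup_lt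
      ((Subgroup.map_lt_map_iff_of_injective c.injective).mp h1)
      ((Subgroup.map_le_map_iff_of_injective c.injective).mp h2)]
end

section
/- Let δ be a permutation of the Fano plane F with ind(δ) = 1. Then G_δ is isomorphic to the alternating group A₄ on 4 letters. -/
/-- A ternary relation that is symmetric and holds only for distinct points. -/
structure IsTripleRel {α : Type*} (R : α → α → α → Prop) : Prop where
  swap : ∀ {x y z}, R x y z → R y x z
  rotate : ∀ {x y z}, R x y z → R y z x
  ne : ∀ {x y z}, R x y z → x ≠ y

namespace IsTripleRel

variable {α : Type*} {R : α → α → α → Prop}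

lemma of_set_eq (hR : IsTripleRel R) {p q r x y z : α} (h : R x y z) (hpq : p ≠ q)
    (hqr : q ≠ r) (hpr : p ≠ r) (hS : ({p, q, r} : Set α) = {x, y, z}) : R p q r := by
  have hp : p ∈ ({x, y, z} : Set α) := hS ▸ by simp
  have hq : q ∈ ({x, y, z} : Set α) := hS ▸ by simp
  have hr : r ∈ ({x, y, z} : Set α) := hS ▸ by simp
  simp only [Set.mem_insert_iff, Set.mem_singleton_iff] at hp hq hr
  have := hR.swap h
  have := hR.rotate h
  have := hR.rotate (hR.rotate h)
  have := hR.swap (hR.rotate h)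
  have := hR.swap (hR.rotate (hR.rotate h))
  rcases hp with rfl | rfl | rfl <;> rcases hq with rfl | rfl | rfl <;>
    rcases hr with rfl | rfl | rfl <;> first | contradiction | assumption

lemma image_iff (hR : IsTripleRel R) (f : Equiv.Perm α) :
    (∀ S : Set α, (∃ x y z, R x y z ∧ S = {x, y, z}) →
      ∃ x y z, R x y z ∧ ⇑f '' S = {x, y, z}) ↔
    ∀ x y z, R x y z → R (f x) (f y) (f z) := by
  constructor
  · intro h x y z hxyz
    obtain ⟨x', y', z', h', hS⟩ := h _ ⟨x, y, z, hxyz, rfl⟩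
    simp only [Set.image_insert_eq, Set.image_singleton] at hS
    exact hR.of_set_eq h' (f.injective.ne (hR.ne hxyz))
      (f.injective.ne (hR.ne (hR.rotate hxyz)))
      (f.injective.ne (hR.ne (hR.rotate (hR.rotate hxyz))).symm) hS
  · rintro h S ⟨x, y, z, hxyz, rfl⟩
    exact ⟨f x, f y, f z, h x y z hxyz, by simp [Set.image_insert_eq]⟩

end IsTripleRel

/-- The points `x`, `y`, `z` form a line of the Fano plane. -/
def FanoCollinear (x y z : FanoPoint) : Prop := x.1 + y.1 + z.1 = 0

lemma isTripleRel_comp_fanoCollinear (δ : Equiv.Perm FanoPoint) :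
    IsTripleRel fun x y z => FanoCollinear (δ x) (δ y) (δ z) where
  swap h := by exact Eq.trans (by abel) h
  rotate h := by exact Eq.trans (by abel) h
  ne {x y z} h := by
    rintro rfl
    unfold FanoCollinear at h
    rw [CharTwo.add_self_eq_zero, zero_add] at h
    exact (δ z).2 h

lemma isTripleRel_fanoCollinear : IsTripleRel FanoCollinear :=
  isTripleRel_comp_fanoCollinear 1

lemma exists_fanoCollinear {x y : FanoPoint} (h : x ≠ y) : ∃ z, FanoCollinear x y z :=
  ⟨⟨x.1 + y.1, fun h0 => h (Subtype.ext (CharTwo.add_eq_zero.1 h0))⟩,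
    CharTwo.add_self_eq_zero _⟩

lemma FanoCollinear.unique {x y z z' : FanoPoint} (h : FanoCollinear x y z)
    (h' : FanoCollinear x y z') : z = z' :=
  Subtype.ext (add_left_cancel (h.trans h'.symm))

lemma isFanoLine_iff (S : Set FanoPoint) :
    IsFanoLine S ↔ ∃ x y z, FanoCollinear x y z ∧ S = {x, y, z} := by
  have key : ∀ {x y z : FanoPoint}, FanoCollinear x y z →
      {w : FanoPoint | w.1 = x.1 ∨ w.1 = y.1 ∨ w.1 = x.1 + y.1} = {x, y, z} := by
    intro x y z hz
    have : x.1 + y.1 = z.1 := CharTwo.add_eq_zero.1 hz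
    ext w
    simp [this, Subtype.ext_iff]
  constructor
  · rintro ⟨x, y, hxy, rfl⟩
    obtain ⟨z, hz⟩ := exists_fanoCollinear hxy
    exact ⟨x, y, z, hz, key hz⟩
  · rintro ⟨x, y, z, hz, rfl⟩
    exact ⟨x, y, isTripleRel_fanoCollinear.ne hz, (key hz).symm⟩

lemma isDeltaLine_iff (δ : Equiv.Perm FanoPoint) (S : Set FanoPoint) :
    IsDeltaLine δ S ↔
      ∃ x y z, FanoCollinear (δ x) (δ y) (δ z) ∧ S = {x, y, z} := by
  simp only [IsDeltaLine, isFanoLine_iff]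
  constructor
  · rintro ⟨_, ⟨x, y, z, h, rfl⟩, rfl⟩
    refine ⟨δ.symm x, δ.symm y, δ.symm z, by simpa using h, ?_⟩
    ext w
    simp [Equiv.eq_symm_apply]
  · rintro ⟨x, y, z, h, rfl⟩
    refine ⟨_, ⟨_, _, _, h, rfl⟩, ?_⟩
    ext w
    simp

lemma mem_Gdelta_iff (δ f : Equiv.Perm FanoPoint) :
    f ∈ Gdelta δ ↔
      (∀ x y z, FanoCollinear x y z → FanoCollinear (f x) (f y) (f z)) ∧
      ∀ x y z, FanoCollinear (δ x) (δ y) (δ z) →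
        FanoCollinear (δ (f x)) (δ (f y)) (δ (f z)) := by
  change (IsFanoAut f ∧ _) ↔ _
  simp only [IsFanoAut, isFanoLine_iff, isDeltaLine_iff]
  rw [isTripleRel_fanoCollinear.image_iff, (isTripleRel_comp_fanoCollinear δ).image_iff]

/-- A permutation of index one has exactly one common line, with distinguished points. -/
lemma exists_unique_common_line {δ : Equiv.Perm FanoPoint} (h1 : fanoIndex δ = 1) :
    ∃ a b c, FanoCollinear a b c ∧ FanoCollinear (δ a) (δ b) (δ c) ∧
      ∀ x y z, FanoCollinear x y z → FanoCollinear (δ x) (δ y) (δ z) →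
        x = a ∨ x = b ∨ x = c := by
  obtain ⟨L, hL⟩ := Set.ncard_eq_one.1 h1
  have mem : ∀ x y z, FanoCollinear x y z → FanoCollinear (δ x) (δ y) (δ z) →
      ({x, y, z} : Set FanoPoint) = L := by
    intro x y z h h'
    rw [← Set.mem_singleton_iff, ← hL]
    exact ⟨(isFanoLine_iff _).2 ⟨x, y, z, h, rfl⟩,
      (isFanoLine_iff _).2 ⟨_, _, _, h', by simp [Set.image_insert_eq]⟩⟩
  have hLm : L ∈ {L : Set FanoPoint | IsFanoLine L ∧ IsFanoLine (⇑δ '' L)} := by simp [hL]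
  obtain ⟨hl, hl'⟩ := hLm
  obtain ⟨a, b, c, h, rfl⟩ := (isFanoLine_iff _).1 hl
  obtain ⟨x, y, z, h', hS⟩ := (isFanoLine_iff _).1 hl'
  simp only [Set.image_insert_eq, Set.image_singleton] at hS
  have hT := isTripleRel_fanoCollinear
  refine ⟨a, b, c, h, hT.of_set_eq h' (δ.injective.ne (hT.ne h))
      (δ.injective.ne (hT.ne (hT.rotate h)))
      (δ.injective.ne (hT.ne (hT.rotate (hT.rotate h))).symm) hS, ?_⟩
  intro x y z hx hx'
  have : x ∈ ({x, y, z} : Set FanoPoint) := by simp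
  rw [mem x y z hx hx'] at this
  simpa using this

/-- Lines of the model of the Fano plane on `Fin 7` where `i` has the binary digits of
`i + 1` as coordinates. -/
abbrev FinCollinear (i j k : Fin 7) : Prop := (i.1 + 1) ^^^ (j.1 + 1) ^^^ (k.1 + 1) = 0

/-- The relabelling of the points of the line `{0, 1, 2}` by a 3-cycle. -/
def cycleLine : Fin 7 → Fin 7 := ![1, 2, 0, 3, 4, 5, 6]

/-- Lines of the relabelled plane, sharing with the standard one only `{0, 1, 2}`. -/
abbrev TwistedCollinear (i j k : Fin 7) : Prop :=
  FinCollinear (cycleLine i) (cycleLine j) (cycleLine k)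

/-- The third point on the line through two points. -/
def thirdPoint (i j : Fin 7) : Fin 7 := Fin.ofNat 7 (((i.1 + 1) ^^^ (j.1 + 1)) - 1)

lemma FinCollinear.eq_thirdPoint :
    ∀ i j k, FinCollinear i j k → k = thirdPoint i j := by
  decide +kernel

lemma exists_fin_model {a b d : FanoPoint} (hab : a ≠ b) (had : d ≠ a) (hbd : d ≠ b)
    (habd : ¬ FanoCollinear a b d) :
    ∃ e : Fin 7 ≃ FanoPoint, e 0 = a ∧ e 1 = b ∧ e 3 = d ∧
      ∀ i j k, FanoCollinear (e i) (e j) (e k) ↔ FinCollinear i j k := by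
  let s : Fin 7 → ZMod 2 := fun i => ((i.1 + 1 : ℕ) : ZMod 2)
  let t : Fin 7 → ZMod 2 := fun i => (((i.1 + 1) / 2 : ℕ) : ZMod 2)
  let u : Fin 7 → ZMod 2 := fun i => (((i.1 + 1) / 4 : ℕ) : ZMod 2)
  have hind : ∀ x y z : ZMod 2, x • a.1 + y • b.1 + z • d.1 = 0 → x = 0 ∧ y = 0 ∧ z = 0 := by
    intro x y z h
    have ha := a.2
    have hb := b.2
    have hd := d.2
    have hab' : a.1 + b.1 ≠ 0 := fun h => hab (Subtype.ext (CharTwo.add_eq_zero.1 h))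
    have had' : a.1 + d.1 ≠ 0 := fun h => had (Subtype.ext (CharTwo.add_eq_zero.1 h).symm)
    have hbd' : b.1 + d.1 ≠ 0 := fun h => hbd (Subtype.ext (CharTwo.add_eq_zero.1 h).symm)
    have habd' : a.1 + b.1 + d.1 ≠ 0 := habd
    have cases : ∀ w : ZMod 2, w = 0 ∨ w = 1 := by decide
    rcases cases x with rfl | rfl <;> rcases cases y with rfl | rfl <;>
      rcases cases z with rfl | rfl <;> simp_all
  let v : Fin 7 → (Fin 3 → ZMod 2) := fun i => s i • a.1 + t i • b.1 + u i • d.1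
  have hv : ∀ i, v i ≠ 0 := by
    intro i h
    have := hind _ _ _ h
    clear h
    revert i
    decide +kernel
  have hinj : Function.Injective v := by
    intro i j h
    have h0 : (s i + s j) • a.1 + (t i + t j) • b.1 + (u i + u j) • d.1 = 0 := by
      refine Eq.trans ?_ (CharTwo.add_eq_zero.2 h)
      simp only [v, add_smul]
      abel
    have := hind _ _ _ h0
    clear h h0
    revert i j
    decide +kernel
  let g : Fin 7 → FanoPoint := fun i => ⟨v i, hv i⟩
  have hg : Function.Bijective g := by
    rw [Fintype.bijective_iff_injective_and_card]
    exact ⟨fun i j h => hinj (congrArg Subtype.val h), by decide +kernel⟩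
  refine ⟨Equiv.ofBijective g hg, ?_, ?_, ?_, ?_⟩
  · have h0 : s 0 = 1 ∧ t 0 = 0 ∧ u 0 = 0 := by decide
    exact Subtype.ext (by simp [g, v, h0])
  · have h0 : s 1 = 0 ∧ t 1 = 1 ∧ u 1 = 0 := by decide
    exact Subtype.ext (by simp [g, v, h0])
  · have h0 : s 3 = 0 ∧ t 3 = 0 ∧ u 3 = 1 := by decide
    exact Subtype.ext (by simp [g, v, h0])
  · intro i j k
    have hsum : v i + v j + v k =
        (s i + s j + s k) • a.1 + (t i + t j + t k) • b.1 + (u i + u j + u k) • d.1 := by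
      simp only [v, add_smul]
      abel
    have hcoord : FinCollinear i j k ↔
        s i + s j + s k = 0 ∧ t i + t j + t k = 0 ∧ u i + u j + u k = 0 := by
      clear hsum
      revert i j k
      decide +kernel
    change v i + v j + v k = 0 ↔ _
    rw [hsum, hcoord]
    exact ⟨hind _ _ _, fun h => by simp [h]⟩

/-- A Steiner system on `Fin 7` meeting the standard one only in `{0, 1, 2}` and containing
`{0, 3, 5}` is the twisted one. -/
lemma iff_twistedCollinear {Q : Fin 7 → Fin 7 → Fin 7 → Prop} (hQ : IsTripleRel Q)
    (hex : ∀ i j, i ≠ j → ∃ k, Q i j k)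
    (huniq : ∀ i j k k', Q i j k → Q i j k' → k = k')
    (hcommon : ∀ i j k, FinCollinear i j k → Q i j k → i = 0 ∨ i = 1 ∨ i = 2)
    (h012 : Q 0 1 2) (h035 : Q 0 3 5) (i j k : Fin 7) :
    Q i j k ↔ TwistedCollinear i j k := by
  have swap := @hQ.swap
  have rotate := @hQ.rotate
  have ne := @hQ.ne
  have h046 : Q 0 4 6 := by
    obtain ⟨k, hk⟩ := hex 0 4 (by decide)
    have h3 := hcommon 3 4 0 (by decide)
    fin_cases k <;> grind
  have h234 : Q 2 3 4 := by
    obtain ⟨k, hk⟩ := hex 2 3 (by decide)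
    have h6 := hcommon 3 6 2 (by decide)
    fin_cases k <;> grind
  have h136 : Q 1 3 6 := by
    obtain ⟨k, hk⟩ := hex 1 3 (by decide)
    fin_cases k <;> grind
  have h145 : Q 1 4 5 := by
    obtain ⟨k, hk⟩ := hex 1 4 (by decide)
    fin_cases k <;> grind
  have h256 : Q 2 5 6 := by
    obtain ⟨k, hk⟩ := hex 2 5 (by decide)
    fin_cases k <;> grind
  have of_twisted : ∀ i j k, TwistedCollinear i j k → Q i j k := by
    intro i j k h
    have hline : ∀ i j k, TwistedCollinear i j k →
        ∃ p ∈ ([(0, 1, 2), (0, 3, 5), (0, 4, 6), (2, 3, 4), (1, 3, 6), (1, 4, 5),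
          (2, 5, 6)] : List (Fin 7 × Fin 7 × Fin 7)), (i, j, k) ∈
          [(p.1, p.2.1, p.2.2), (p.2.1, p.2.2, p.1), (p.2.2, p.1, p.2.1),
            (p.2.1, p.1, p.2.2), (p.1, p.2.2, p.2.1), (p.2.2, p.2.1, p.1)] := by
      decide +kernel
    obtain ⟨⟨x, y, z⟩, hxyz, hperm⟩ := hline i j k h
    have hx : Q x y z := by
      simp only [List.mem_cons, Prod.mk.injEq, List.not_mem_nil, or_false] at hxyz
      rcases hxyz with ⟨rfl, rfl, rfl⟩ | ⟨rfl, rfl, rfl⟩ | ⟨rfl, rfl, rfl⟩ | ⟨rfl, rfl, rfl⟩ |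
        ⟨rfl, rfl, rfl⟩ | ⟨rfl, rfl, rfl⟩ | ⟨rfl, rfl, rfl⟩ <;> assumption
    simp only [List.mem_cons, Prod.mk.injEq, List.not_mem_nil, or_false] at hperm
    rcases hperm with ⟨rfl, rfl, rfl⟩ | ⟨rfl, rfl, rfl⟩ | ⟨rfl, rfl, rfl⟩ | ⟨rfl, rfl, rfl⟩ |
      ⟨rfl, rfl, rfl⟩ | ⟨rfl, rfl, rfl⟩
    exacts [hx, rotate hx, rotate (rotate hx), swap hx, swap (rotate (rotate hx)),
      swap (rotate hx)]
  refine ⟨fun h => ?_, of_twisted i j k⟩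
  have hthird : ∀ i j : Fin 7, i ≠ j → ∃ k, TwistedCollinear i j k := by decide +kernel
  obtain ⟨k', hk'⟩ := hthird i j (ne h)
  rwa [huniq i j k k' h (of_twisted i j k' hk')]

/-- The action on the Fano plane of a permutation of the complement `{3, 4, 5, 6}` of the
line `{0, 1, 2}`. -/
def extendPerm (σ : Equiv.Perm (Fin 4)) (i : Fin 7) : Fin 7 :=
  if h : 3 ≤ i.1 then Fin.natAdd 3 (σ ⟨i.1 - 3, by omega⟩)
  else thirdPoint (Fin.natAdd 3 (σ 0)) (Fin.natAdd 3 (σ ⟨i.1 + 1, by omega⟩))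

lemma extendPerm_mul : ∀ σ τ : Equiv.Perm (Fin 4), ∀ i,
    extendPerm (σ * τ) i = extendPerm σ (extendPerm τ i) := by
  decide +kernel

lemma extendPerm_one : ∀ i, extendPerm 1 i = i := by
  decide +kernel

/-- `extendPerm` as a homomorphism. -/
def extendPermHom : Equiv.Perm (Fin 4) →* Equiv.Perm (Fin 7) where
  toFun σ :=
    { toFun := extendPerm σ
      invFun := extendPerm σ⁻¹
      left_inv i := by rw [← extendPerm_mul, inv_mul_cancel, extendPerm_one]
      right_inv i := by rw [← extendPerm_mul, mul_inv_cancel, extendPerm_one] }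
  map_one' := Equiv.ext extendPerm_one
  map_mul' σ τ := Equiv.ext (extendPerm_mul σ τ)

lemma extendPermHom_injective : Function.Injective extendPermHom := by
  intro σ τ h
  have h' : ∀ i, extendPerm σ i = extendPerm τ i := fun i => Equiv.congr_fun h i
  clear h
  revert σ τ
  decide +kernel

lemma extendPerm_finCollinear : ∀ σ : Equiv.Perm (Fin 4), ∀ i j k,
    FinCollinear i j k → FinCollinear (extendPerm σ i) (extendPerm σ j) (extendPerm σ k) := by
  decide +kernel

lemma extendPerm_twistedCollinear : ∀ σ : Equiv.Perm (Fin 4), Equiv.Perm.sign σ = 1 →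
    ∀ i j k, TwistedCollinear i j k →
      TwistedCollinear (extendPerm σ i) (extendPerm σ j) (extendPerm σ k) := by
  decide +kernel

/-- The map determined by the images of the points `0`, `1`, `3`. -/
def spanMap (x y z : Fin 7) : Fin 7 → Fin 7 :=
  ![x, y, thirdPoint x y, z, thirdPoint x z, thirdPoint y z, thirdPoint (thirdPoint x y) z]

lemma exists_extendPerm_eq_spanMap : ∀ x y z : Fin 7, x ≠ y → x ≠ z → y ≠ z →
    z ≠ thirdPoint x y →
    (∀ i j k, TwistedCollinear i j k →
      TwistedCollinear (spanMap x y z i) (spanMap x y z j) (spanMap x y z k)) →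
    ∃ σ : Equiv.Perm (Fin 4), Equiv.Perm.sign σ = 1 ∧ ∀ i, extendPerm σ i = spanMap x y z i := by
  decide +kernel

lemma mem_map_extendPermHom_iff (f : Equiv.Perm (Fin 7)) :
    f ∈ (alternatingGroup (Fin 4)).map extendPermHom ↔
      (∀ i j k, FinCollinear i j k → FinCollinear (f i) (f j) (f k)) ∧
      ∀ i j k, TwistedCollinear i j k → TwistedCollinear (f i) (f j) (f k) := by
  constructor
  · rintro ⟨σ, hσ, rfl⟩
    exact ⟨extendPerm_finCollinear σ, extendPerm_twistedCollinear σ hσ⟩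
  · rintro ⟨h, h'⟩
    have h2 := (h 0 1 2 (by decide)).eq_thirdPoint
    have h4 := (h 0 3 4 (by decide)).eq_thirdPoint
    have h5 := (h 1 3 5 (by decide)).eq_thirdPoint
    have h6 := (h 2 3 6 (by decide)).eq_thirdPoint
    have hf : ∀ i, f i = spanMap (f 0) (f 1) (f 3) i := by
      intro i
      fin_cases i
      · rfl
      · rfl
      · exact h2
      · rfl
      · exact h4
      · exact h5
      · exact h6.trans (by rw [h2]; rfl)
    obtain ⟨σ, hσ, hσf⟩ := exists_extendPerm_eq_spanMap (f 0) (f 1) (f 3)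
      (f.injective.ne (by decide)) (f.injective.ne (by decide)) (f.injective.ne (by decide))
      (h2 ▸ f.injective.ne (by decide)) (fun i j k hijk => by
        rw [← hf, ← hf, ← hf]
        exact h' i j k hijk)
    exact ⟨σ, hσ, Equiv.ext fun i => (hσf i).trans (hf i).symm⟩

/-- A plane and its `δ`-lines are simultaneously isomorphic to the standard and twisted models
when `ind(δ) = 1`. -/
lemma exists_fin_model_of_fanoIndex_eq_one {δ : Equiv.Perm FanoPoint} (h1 : fanoIndex δ = 1) :
    ∃ e : Fin 7 ≃ FanoPoint,
      (∀ i j k, FanoCollinear (e i) (e j) (e k) ↔ FinCollinear i j k) ∧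
      ∀ i j k, FanoCollinear (δ (e i)) (δ (e j)) (δ (e k)) ↔ TwistedCollinear i j k := by
  obtain ⟨a, b, c, habc, habc', hcommon⟩ := exists_unique_common_line h1
  have hT := isTripleRel_fanoCollinear
  have hD := isTripleRel_comp_fanoCollinear δ
  obtain ⟨d, hd⟩ : ∃ d, d ∉ ({a, b, c} : Finset FanoPoint) := by
    by_contra! hall
    have hcard : Fintype.card FanoPoint = 7 := by decide +kernel
    have := Finset.card_le_three (a := a) (b := b) (c := c)
    rw [Finset.eq_univ_iff_forall.2 hall, Finset.card_univ, hcard] at this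
    omega
  simp only [Finset.mem_insert, Finset.mem_singleton, not_or] at hd
  obtain ⟨hda, hdb, hdc⟩ := hd
  have twisted_iff : ∀ e : Fin 7 ≃ FanoPoint, e 0 = a →
      (e 1 = b ∧ e 2 = c ∨ e 1 = c ∧ e 2 = b) →
      (∀ i j k, FanoCollinear (e i) (e j) (e k) ↔ FinCollinear i j k) →
      FanoCollinear (δ (e 0)) (δ (e 3)) (δ (e 5)) →
      ∀ i j k, FanoCollinear (δ (e i)) (δ (e j)) (δ (e k)) ↔ TwistedCollinear i j k := by
    intro e he0 he12 he h035
    refine iff_twistedCollinear (Q := fun i j k => FanoCollinear (δ (e i)) (δ (e j)) (δ (e k)))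
      ⟨fun h => hD.swap h, fun h => hD.rotate h, fun h hij => hD.ne h (congrArg e hij)⟩
      ?_ ?_ ?_ ?_ h035
    · intro i j hij
      obtain ⟨z, hz⟩ := exists_fanoCollinear (δ.injective.ne (e.injective.ne hij))
      exact ⟨e.symm (δ.symm z), by simpa using hz⟩
    · intro i j k k' h h'
      exact e.injective (δ.injective (h.unique h'))
    · intro i j k h h'
      have := hcommon _ _ _ ((he i j k).2 h) h'
      simp only [← e.injective.eq_iff]
      grind
    · rcases he12 with ⟨h, h'⟩ | ⟨h, h'⟩
      · rw [he0, h, h']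
        exact habc'
      · rw [he0, h, h']
        exact hD.swap (hD.rotate (hD.rotate habc'))
  obtain ⟨e, he0, he1, he3, he⟩ := exists_fin_model (hT.ne habc) hda hdb
    (fun h => hdc (h.unique habc))
  have he2 : e 2 = c := ((he 0 1 2).2 (by decide)).unique (by rwa [he0, he1])
  obtain ⟨z, hz⟩ := exists_fanoCollinear (δ.injective.ne (Ne.symm hda))
  obtain ⟨k, hk⟩ : ∃ k, δ (e k) = z := ⟨e.symm (δ.symm z), by simp⟩
  rw [← hk, ← he0, ← he3] at hz
  have hline : FanoCollinear (δ (e 0)) (δ (e 1)) (δ (e 2)) := by rwa [he0, he1, he2]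
  have hk56 : k = 5 ∨ k = 6 := by
    have k0 : k ≠ 0 := by
      rintro rfl
      exact hD.ne (hD.rotate (hD.rotate hz)) rfl
    have k3 : k ≠ 3 := by
      rintro rfl
      exact hD.ne (hD.rotate hz) rfl
    have k1 : k ≠ 1 := by
      rintro rfl
      have := FanoCollinear.unique (hD.swap (hD.rotate (hD.rotate hz))) hline
      exact absurd (e.injective (δ.injective this)) (by decide)
    have k2 : k ≠ 2 := by
      rintro rfl
      have := FanoCollinear.unique (hD.swap (hD.rotate (hD.rotate hz)))
        (hD.swap (hD.rotate (hD.rotate hline)))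
      exact absurd (e.injective (δ.injective this)) (by decide)
    have k4 : k ≠ 4 := by
      rintro rfl
      have := hcommon _ _ _ ((he 3 4 0).2 (by decide)) (hD.rotate hz)
      rw [he3] at this
      tauto
    omega
  rcases hk56 with rfl | rfl
  · exact ⟨e, he, twisted_iff e he0 (.inl ⟨he1, he2⟩) he hz⟩
  · let s : Equiv.Perm (Fin 7) := Equiv.swap 1 2 * Equiv.swap 5 6
    have hs : ∀ i j k, FinCollinear (s i) (s j) (s k) ↔ FinCollinear i j k := by
      decide +kernel
    have hse : ∀ i j k, FanoCollinear ((s.trans e) i) ((s.trans e) j) ((s.trans e) k) ↔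
        FinCollinear i j k := fun i j k => (he _ _ _).trans (hs i j k)
    exact ⟨s.trans e, hse, twisted_iff _ he0 (.inr ⟨he2, he1⟩) hse hz⟩

/-- if `ind(δ) = 1`, then `G_δ` is isomorphic to the alternating group
`A₄`. -/
theorem stmt7 (δ : Equiv.Perm FanoPoint) (h1 : fanoIndex δ = 1) :
    Nonempty (↥(Gdelta δ) ≃* ↥(alternatingGroup (Fin 4))) := by
  obtain ⟨e, he, he'⟩ := exists_fin_model_of_fanoIndex_eq_one h1
  have hmap : (Gdelta δ).map e.symm.permCongrHom.toMonoidHom =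
      (alternatingGroup (Fin 4)).map extendPermHom := by
    ext f
    rw [mem_map_extendPermHom_iff, Subgroup.mem_map_equiv, mem_Gdelta_iff]
    have hf : ∀ i, e.symm.permCongrHom.symm f (e i) = e (f i) := fun i => by simp
    simp only [e.surjective.forall, hf, he, he']
  exact ⟨((Gdelta δ).equivMapOfInjective _ e.symm.permCongrHom.injective).trans
    ((MulEquiv.subgroupCongr hmap).trans
      ((alternatingGroup (Fin 4)).equivMapOfInjective _ extendPermHom_injective).symm)⟩
end

section
/- Let δ be a permutation of the Fano plane F with ind(δ) = 3, and suppose that the three lines L of F for which δ(L) is a line all pass through a common point p. Then G_δ equals the stabilizer of p in the full automorphism group of F, and in particular G_δ is isomorphic to the symmetric group S₄ on 4 letters. -/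
/-- The line through two points of the Fano plane. -/
def fanoLine (x y : FanoPoint) : Set FanoPoint :=
  {z | z.1 = x.1 ∨ z.1 = y.1 ∨ z.1 = x.1 + y.1}

lemma isFanoLine_fanoLine {x y : FanoPoint} (h : x ≠ y) : IsFanoLine (fanoLine x y) :=
  ⟨x, y, h, rfl⟩

lemma add_self_eq_zero_of_fano (v : Fin 3 → ZMod 2) : v + v = 0 :=
  funext fun i => CharTwo.add_self_eq_zero (v i)

lemma exists_val_eq_add {x y : FanoPoint} (h : x ≠ y) : ∃ z : FanoPoint, z.1 = x.1 + y.1 := by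
  refine ⟨⟨x.1 + y.1, fun h0 => h (Subtype.ext ?_)⟩, rfl⟩
  have := add_self_eq_zero_of_fano y.1
  grind

lemma val_eq_add_perm {x y z : FanoPoint} (h : z.1 = x.1 + y.1) :
    z.1 = y.1 + x.1 ∧ x.1 = z.1 + y.1 ∧ y.1 = z.1 + x.1 := by
  have := add_self_eq_zero_of_fano x.1
  have := add_self_eq_zero_of_fano y.1
  refine ⟨?_, ?_, ?_⟩ <;> grind

lemma ne_of_val_eq_add {x y z : FanoPoint} (h : z.1 = x.1 + y.1) : x ≠ y ∧ z ≠ x ∧ z ≠ y := by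
  refine ⟨?_, ?_, ?_⟩ <;> rintro rfl
  · exact z.2 (h.trans (add_self_eq_zero_of_fano _))
  · exact y.2 (by simpa using h)
  · exact x.2 (by simpa using h)

lemma fanoLine_eq_triple {x y z : FanoPoint} (h : z.1 = x.1 + y.1) :
    fanoLine x y = {x, y, z} := by
  ext w
  simp [fanoLine, ← h, Subtype.ext_iff]

lemma IsFanoLine.val_eq_add_of_mem {L : Set FanoPoint} (hL : IsFanoLine L) {x y z : FanoPoint}
    (hx : x ∈ L) (hy : y ∈ L) (hz : z ∈ L) (hxy : x ≠ y) (hzx : z ≠ x) (hzy : z ≠ y) :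
    z.1 = x.1 + y.1 := by
  obtain ⟨a, b, hab, rfl⟩ := hL
  obtain ⟨c, hc⟩ := exists_val_eq_add hab
  obtain ⟨h1, h2, h3⟩ := val_eq_add_perm hc
  simp only [Set.mem_ofPred_eq, ← hc, ← Subtype.ext_iff] at hx hy hz
  have h4 := h2.trans (add_comm _ _)
  have h5 := h3.trans (add_comm _ _)
  rcases hx with rfl | rfl | rfl <;> rcases hy with rfl | rfl | rfl <;>
    rcases hz with rfl | rfl | rfl <;> first | contradiction | assumption

lemma IsFanoLine.eq_fanoLine {L : Set FanoPoint} (hL : IsFanoLine L) {x : FanoPoint}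
    (hx : x ∈ L) : ∃ y, y ≠ x ∧ L = fanoLine x y := by
  obtain ⟨a, b, hab, rfl⟩ := hL
  obtain ⟨c, hc⟩ := exists_val_eq_add hab
  obtain ⟨h1, h2, h3⟩ := val_eq_add_perm hc
  obtain ⟨n1, n2, n3⟩ := ne_of_val_eq_add hc
  have key : fanoLine a b = {a, b, c} := fanoLine_eq_triple hc
  change x ∈ fanoLine a b at hx
  change ∃ y, y ≠ x ∧ fanoLine a b = fanoLine x y
  rw [key] at hx ⊢
  rcases hx with rfl | rfl | rfl
  · exact ⟨b, n1.symm, (fanoLine_eq_triple hc).symm⟩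
  · exact ⟨a, n1, by rw [fanoLine_eq_triple h1, Set.insert_comm]⟩
  · refine ⟨a, n2.symm, ?_⟩
    rw [fanoLine_eq_triple h3]
    ext w
    simp only [Set.mem_insert_iff, Set.mem_singleton_iff]
    tauto

lemma isFanoLine_image_iff (g : Equiv.Perm FanoPoint) {x y z : FanoPoint}
    (h : z.1 = x.1 + y.1) :
    IsFanoLine (⇑g '' fanoLine x y) ↔ (g z).1 = (g x).1 + (g y).1 := by
  obtain ⟨n1, n2, n3⟩ := ne_of_val_eq_add h
  rw [fanoLine_eq_triple h]
  constructor
  · intro hL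
    exact hL.val_eq_add_of_mem (by simp) (by simp) (by simp) (g.injective.ne n1)
      (g.injective.ne n2) (g.injective.ne n3)
  · intro hg
    have := isFanoLine_fanoLine (g.injective.ne n1)
    rw [fanoLine_eq_triple hg] at this
    simpa [Set.image_insert_eq] using this

lemma isFanoAut_iff {f : Equiv.Perm FanoPoint} :
    IsFanoAut f ↔ ∀ x y z : FanoPoint, z.1 = x.1 + y.1 → (f z).1 = (f x).1 + (f y).1 := by
  constructor
  · intro hf x y z h
    exact (isFanoLine_image_iff f h).1 (hf _ (isFanoLine_fanoLine (ne_of_val_eq_add h).1))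
  · rintro hf _ ⟨x, y, hxy, rfl⟩
    obtain ⟨z, hz⟩ := exists_val_eq_add hxy
    exact (isFanoLine_image_iff f hz).2 (hf x y z hz)

lemma isDeltaLine_iff_s8 {δ : Equiv.Perm FanoPoint} {S : Set FanoPoint} :
    IsDeltaLine δ S ↔ IsFanoLine (⇑δ '' S) := by
  constructor
  · rintro ⟨L, hL, rfl⟩
    rwa [Set.image_preimage_eq _ δ.surjective]
  · exact fun h => ⟨_, h, (Set.preimage_image_eq _ δ.injective).symm⟩

lemma exists_independent (p q : FanoPoint) :
    ∃ a : FanoPoint, a ≠ p ∧ a ≠ q ∧ a.1 ≠ p.1 + q.1 := by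
  revert p q; decide +kernel

set_option synthInstance.maxSize 1000 in
lemma eq_of_independent (p x y c : FanoPoint) (hxy : x ≠ y) (hxp : x ≠ p) (hyp : y ≠ p)
    (hs : x.1 + y.1 ≠ p.1) : c = p ∨ c = x ∨ c = y ∨ c.1 = p.1 + x.1 ∨ c.1 = p.1 + y.1 ∨
      c.1 = x.1 + y.1 ∨ c.1 = x.1 + y.1 + p.1 := by
  revert p x y c; decide +kernel

lemma ncard_lines_through_le (p : FanoPoint) :
    {L : Set FanoPoint | IsFanoLine L ∧ p ∈ L}.ncard ≤ 3 := by
  classical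
  obtain ⟨a, hap, -, -⟩ := exists_independent p p
  obtain ⟨b, hbp, hba, hpab⟩ := exists_independent p a
  obtain ⟨c, hc⟩ := exists_val_eq_add hba.symm
  have hsub : {L : Set FanoPoint | IsFanoLine L ∧ p ∈ L} ⊆
      (({fanoLine p a, fanoLine p b, fanoLine p c} : Finset (Set FanoPoint)) :
        Set (Set FanoPoint)) := by
    rintro L ⟨hL, hpL⟩
    obtain ⟨y, hy, rfl⟩ := hL.eq_fanoLine hpL
    have hswap : ∀ u : FanoPoint, y.1 = p.1 + u.1 → fanoLine p y = fanoLine p u := by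
      intro u hu
      rw [fanoLine_eq_triple hu, fanoLine_eq_triple ((val_eq_add_perm hu).2.2.trans (add_comm _ _))]
      ext w
      simp only [Set.mem_insert_iff, Set.mem_singleton_iff]
      tauto
    have hs : a.1 + b.1 ≠ p.1 := by
      intro h
      exact hpab (val_eq_add_perm h.symm).2.2
    simp only [Finset.coe_insert, Finset.coe_singleton, Set.mem_insert_iff,
      Set.mem_singleton_iff]
    rcases eq_of_independent p a b y hba.symm hap hbp hs with h | rfl | rfl | h | h | h | h
    · exact absurd h hy
    · exact .inl rfl
    · exact .inr (.inl rfl)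
    · exact .inl (hswap _ h)
    · exact .inr (.inl (hswap _ h))
    · exact .inr (.inr (by rw [Subtype.ext (h.trans hc.symm)]))
    · exact .inr (.inr (hswap _ (by rw [h, hc, add_comm])))
  exact (Set.ncard_le_ncard hsub (Finset.finite_toSet _)).trans
    ((Set.ncard_coe_finset _).trans_le Finset.card_le_three)

lemma image_line_through {δ : Equiv.Perm FanoPoint} (h3 : fanoIndex δ = 3) {p : FanoPoint}
    (hp : ∀ L : Set FanoPoint, IsFanoLine L → IsFanoLine (⇑δ '' L) → p ∈ L)
    {L : Set FanoPoint} (hL : IsFanoLine L) (hpL : p ∈ L) : IsFanoLine (⇑δ '' L) := by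
  have h := Set.eq_of_subset_of_ncard_le
    (s := {L : Set FanoPoint | IsFanoLine L ∧ IsFanoLine (⇑δ '' L)})
    (t := {L : Set FanoPoint | IsFanoLine L ∧ p ∈ L})
    (fun L hL => ⟨hL.1, hp L hL.1 hL.2⟩)
    ((ncard_lines_through_le p).trans_eq h3.symm) (Set.toFinite _)
  exact (h.symm.subset ⟨hL, hpL⟩ : L ∈ {L | IsFanoLine L ∧ IsFanoLine (⇑δ '' L)}).2

lemma map_add_of_independent {δ : Equiv.Perm FanoPoint} {p : FanoPoint}
    (hpencil : ∀ x z : FanoPoint, z.1 = p.1 + x.1 → (δ z).1 = (δ p).1 + (δ x).1)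
    (hother : ∀ x y z : FanoPoint, z.1 = x.1 + y.1 → (δ z).1 = (δ x).1 + (δ y).1 →
      p = x ∨ p = y ∨ p = z)
    {x y c : FanoPoint} (hxp : x ≠ p) (hyp : y ≠ p) (hs : x.1 + y.1 ≠ p.1)
    (hcp : c ≠ p) (hc : (δ c).1 = (δ x).1 + (δ y).1) : c.1 = x.1 + y.1 + p.1 := by
  obtain ⟨n1, n2, n3⟩ := ne_of_val_eq_add hc
  have hxy : x ≠ y := fun h => n1 (h ▸ rfl)
  rcases eq_of_independent p x y c hxy hxp hyp hs with h | h | h | h | h | h | h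
  · exact absurd h hcp
  · exact absurd (h ▸ rfl) n2
  · exact absurd (h ▸ rfl) n3
  · have := hpencil x c h
    rw [hc, add_comm] at this
    exact absurd (δ.injective (Subtype.ext (add_right_cancel this))) hyp
  · have := hpencil y c h
    rw [hc] at this
    exact absurd (δ.injective (Subtype.ext (add_right_cancel this))) hxp
  · rcases hother x y c h hc with h | h | h
    · exact absurd h.symm hxp
    · exact absurd h.symm hyp
    · exact absurd h.symm hcp
  · exact h

lemma map_add_of_mem_stabilizer {δ : Equiv.Perm FanoPoint} {p : FanoPoint}
    (hpencil : ∀ x z : FanoPoint, z.1 = p.1 + x.1 → (δ z).1 = (δ p).1 + (δ x).1)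
    (hother : ∀ x y z : FanoPoint, z.1 = x.1 + y.1 → (δ z).1 = (δ x).1 + (δ y).1 →
      p = x ∨ p = y ∨ p = z)
    {f : Equiv.Perm FanoPoint} (hf : IsFanoAut f) (hfp : f p = p)
    {x y c : FanoPoint} (hc : (δ c).1 = (δ x).1 + (δ y).1) :
    (δ (f c)).1 = (δ (f x)).1 + (δ (f y)).1 := by
  rw [isFanoAut_iff] at hf
  have hline : ∀ {y c : FanoPoint}, (δ c).1 = (δ p).1 + (δ y).1 →
      c.1 = p.1 + y.1 ∧ (δ (f c)).1 = (δ p).1 + (δ (f y)).1 := by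
    intro y c h
    have hpy : p ≠ y := fun h' => (ne_of_val_eq_add h).1 (h' ▸ rfl)
    obtain ⟨z, hz⟩ := exists_val_eq_add hpy
    obtain rfl : c = z := δ.injective (Subtype.ext (h.trans (hpencil _ _ hz).symm))
    refine ⟨hz, hpencil _ _ ?_⟩
    rw [hf _ _ _ hz, hfp]
  by_cases hxp : x = p
  · subst hxp
    rw [hfp]
    exact (hline hc).2
  by_cases hyp : y = p
  · subst hyp
    rw [hfp, add_comm]
    exact (hline (val_eq_add_perm hc).1).2
  by_cases hcp : c = p
  · subst hcp
    rw [hfp]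
    exact (val_eq_add_perm (hline (val_eq_add_perm hc).2.1).2).2.1
  have hxy : x ≠ y := fun h => (ne_of_val_eq_add hc).1 (h ▸ rfl)
  have hs : x.1 + y.1 ≠ p.1 := by
    intro h
    have h' := hpencil y x (val_eq_add_perm h.symm).2.1
    have := (val_eq_add_perm h').2.1
    exact hcp (δ.injective (Subtype.ext (hc.trans this.symm)))
  have hcxy := map_add_of_independent hpencil hother hxp hyp hs hcp hc
  obtain ⟨s, hsv⟩ := exists_val_eq_add hxy
  have hsp : s ≠ p := fun h => hs (by rw [← hsv, h])
  have hfs := hf _ _ _ hsv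
  have hfc := hf s p c (by rw [hcxy, hsv])
  rw [hfp, hfs] at hfc
  have hfx : f x ≠ p := fun h => hxp (f.injective (h.trans hfp.symm))
  have hfy : f y ≠ p := fun h => hyp (f.injective (h.trans hfp.symm))
  have hfsp : f s ≠ p := fun h => hsp (f.injective (h.trans hfp.symm))
  have hne : (f x).1 + (f y).1 ≠ p.1 := fun h => hfsp (Subtype.ext (hfs.trans h))
  obtain ⟨d, hd⟩ := exists_val_eq_add (δ.injective.ne (f.injective.ne hxy))
  obtain ⟨d, rfl⟩ := δ.surjective d
  have hdp : d ≠ p := by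
    rintro rfl
    have h1 := (val_eq_add_perm hd).2.1
    have hpy : d ≠ f y := hfy.symm
    obtain ⟨z, hz⟩ := exists_val_eq_add hpy
    have : f x = z := δ.injective (Subtype.ext (h1.trans (hpencil _ _ hz).symm))
    subst this
    exact hne (val_eq_add_perm hz).2.1.symm
  have := map_add_of_independent hpencil hother hfx hfy hne hdp hd
  rw [Subtype.ext (hfc.trans this.symm)]
  exact hd

lemma Gdelta_eq_stabilizer {δ : Equiv.Perm FanoPoint} (h3 : fanoIndex δ = 3) {p : FanoPoint}
    (hp : ∀ L : Set FanoPoint, IsFanoLine L → IsFanoLine (⇑δ '' L) → p ∈ L) :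
    Gdelta δ = fanoAutGroup ⊓ MulAction.stabilizer (Equiv.Perm FanoPoint) p := by
  have hpencil : ∀ x z : FanoPoint, z.1 = p.1 + x.1 → (δ z).1 = (δ p).1 + (δ x).1 := by
    intro x z h
    exact (isFanoLine_image_iff δ h).1 (image_line_through h3 hp
      (isFanoLine_fanoLine (ne_of_val_eq_add h).1) (Or.inl rfl))
  have hother : ∀ x y z : FanoPoint, z.1 = x.1 + y.1 → (δ z).1 = (δ x).1 + (δ y).1 →
      p = x ∨ p = y ∨ p = z := by
    intro x y z h hz
    have := hp _ (isFanoLine_fanoLine (ne_of_val_eq_add h).1) ((isFanoLine_image_iff δ h).2 hz)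
    rw [fanoLine_eq_triple h] at this
    simpa using this
  ext f
  constructor
  · rintro ⟨hf, hfδ⟩
    refine ⟨hf, ?_⟩
    change f p = p
    obtain ⟨q, hq⟩ := f.surjective p
    have hmem : ∀ x : FanoPoint, p ≠ x → q ∈ fanoLine p x := by
      intro x hx
      have hL := isFanoLine_fanoLine hx
      have hδL := image_line_through h3 hp hL (Or.inl rfl)
      obtain ⟨r, hr, hrp⟩ := hp _ (hf _ hL)
        (isDeltaLine_iff_s8.1 (hfδ _ (isDeltaLine_iff_s8.2 hδL)))
      rwa [f.injective (hq.trans hrp.symm)]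
    obtain ⟨x, hxp, hxq, hxs⟩ := exists_independent p q
    rcases hmem x hxp.symm with h | h | h
    · rwa [Subtype.ext h] at hq
    · exact absurd (Subtype.ext h.symm) hxq
    · exact absurd ((val_eq_add_perm h).2.2.trans (add_comm _ _)) hxs
  · rintro ⟨hf, hfp⟩
    refine ⟨hf, ?_⟩
    rintro _ ⟨L, ⟨u, v, huv, rfl⟩, rfl⟩
    change IsDeltaLine δ (⇑f '' (⇑δ ⁻¹' fanoLine u v))
    obtain ⟨w, hw⟩ := exists_val_eq_add huv
    obtain ⟨x, rfl⟩ := δ.surjective u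
    obtain ⟨y, rfl⟩ := δ.surjective v
    obtain ⟨c, rfl⟩ := δ.surjective w
    have hfc := map_add_of_mem_stabilizer hpencil hother hf hfp hw
    have hpre : ⇑δ ⁻¹' fanoLine (δ x) (δ y) = {x, y, c} := by
      rw [fanoLine_eq_triple hw]
      ext z
      simp
    have hline := isFanoLine_fanoLine (ne_of_val_eq_add hfc).1
    rw [fanoLine_eq_triple hfc] at hline
    rw [isDeltaLine_iff_s8, hpre]
    simpa [Set.image_insert_eq] using hline

/-- The linear functionals on `(ZMod 2)³` taking the value `1` at `p`; their kernels are the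
lines not passing through `p`. -/
abbrev FunctionalAt (p : FanoPoint) : Type := {φ : Fin 3 → ZMod 2 // φ ⬝ᵥ p.1 = 1}

lemma card_functionalAt (p : FanoPoint) : Fintype.card (FunctionalAt p) = 4 := by
  revert p; decide +kernel

lemma functionalAt_separates (p : FanoPoint) (v : Fin 3 → ZMod 2)
    (h : ∀ φ : FunctionalAt p, φ.1 ⬝ᵥ v = 0) : v = 0 := by
  revert p v; decide +kernel

lemma sum_functionalAt (p : FanoPoint) (v : Fin 3 → ZMod 2) :
    ∑ φ : FunctionalAt p, φ.1 ⬝ᵥ v = 0 := by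
  revert p v; decide +kernel

lemma exists_dotProduct_eq (p : FanoPoint) (w : FunctionalAt p → ZMod 2) (hw : ∑ φ, w φ = 0) :
    ∃ v : Fin 3 → ZMod 2, ∀ φ : FunctionalAt p, φ.1 ⬝ᵥ v = w φ := by
  revert p w; decide +kernel

lemma eq_of_functionalAt {p x y : FanoPoint}
    (h : ∀ φ : FunctionalAt p, φ.1 ⬝ᵥ x.1 = φ.1 ⬝ᵥ y.1) : x = y := by
  refine Subtype.ext (sub_eq_zero.1 (functionalAt_separates p _ fun φ => ?_))
  rw [dotProduct_sub, h, sub_self]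

lemma exists_functional_perm (p : FanoPoint) (σ : Equiv.Perm (FunctionalAt p)) (x : FanoPoint) :
    ∃ y : FanoPoint, ∀ φ : FunctionalAt p, φ.1 ⬝ᵥ y.1 = (σ⁻¹ φ).1 ⬝ᵥ x.1 := by
  obtain ⟨v, hv⟩ := exists_dotProduct_eq p (fun φ => (σ⁻¹ φ).1 ⬝ᵥ x.1)
    ((Equiv.sum_comp σ⁻¹ fun φ : FunctionalAt p => φ.1 ⬝ᵥ x.1).trans (sum_functionalAt p x.1))
  refine ⟨⟨v, ?_⟩, hv⟩
  rintro rfl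
  refine x.2 (functionalAt_separates p _ fun φ => ?_)
  simpa using (hv (σ φ)).symm

lemma card_stabilizer_le (p : FanoPoint) :
    Nat.card ↥(fanoAutGroup ⊓ MulAction.stabilizer (Equiv.Perm FanoPoint) p) ≤ 24 := by
  obtain ⟨a, hap, -, -⟩ := exists_independent p p
  obtain ⟨b, hbp, hba, hpab⟩ := exists_independent p a
  have hab : a.1 + b.1 ≠ p.1 := fun h => hpab (val_eq_add_perm h.symm).2.2
  have hcard : Nat.card {q : FanoPoint × FanoPoint //
      q.1 ≠ p ∧ q.2 ≠ p ∧ q.2 ≠ q.1 ∧ q.2.1 ≠ p.1 + q.1.1} = 24 := by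
    rw [Nat.card_eq_fintype_card]
    clear hap hbp hba hpab hab a b
    revert p; decide +kernel
  rw [← hcard]
  have hmem : ∀ f : ↥(fanoAutGroup ⊓ MulAction.stabilizer (Equiv.Perm FanoPoint) p),
      f.1 p = p ∧ ∀ x y z : FanoPoint, z.1 = x.1 + y.1 →
        (f.1 z).1 = (f.1 x).1 + (f.1 y).1 :=
    fun f => ⟨f.2.2, isFanoAut_iff.1 f.2.1⟩
  obtain ⟨s, hs⟩ := exists_val_eq_add hap.symm
  refine Nat.card_le_card_of_injective
    (fun f => ⟨(f.1 a, f.1 b), ?_, ?_, f.1.injective.ne hba, ?_⟩) ?_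
  · exact fun h => hap (f.1.injective (h.trans (hmem f).1.symm))
  · exact fun h => hbp (f.1.injective (h.trans (hmem f).1.symm))
  · intro h
    have h' := (hmem f).2 _ _ _ hs
    rw [(hmem f).1] at h'
    exact hpab ((Subtype.ext_iff.1 (f.1.injective (Subtype.ext (h.trans h'.symm)))).trans hs)
  · intro f g hfg
    simp only [Subtype.mk.injEq, Prod.mk.injEq] at hfg
    obtain ⟨hfa, hfb⟩ := hfg
    obtain ⟨hfp, hf⟩ := hmem f
    obtain ⟨hgp, hg⟩ := hmem g
    have hadd : ∀ x y z : FanoPoint, z.1 = x.1 + y.1 → f.1 x = g.1 x → f.1 y = g.1 y →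
        f.1 z = g.1 z := by
      intro x y z h hx hy
      exact Subtype.ext (by rw [hf _ _ _ h, hg _ _ _ h, hx, hy])
    have hp : f.1 p = g.1 p := hfp.trans hgp.symm
    obtain ⟨t, ht⟩ := exists_val_eq_add hba.symm
    refine Subtype.ext (Equiv.ext fun c => ?_)
    rcases eq_of_independent p a b c hba.symm hap hbp hab with
      rfl | rfl | rfl | h | h | h | h
    · exact hp
    · exact hfa
    · exact hfb
    · exact hadd _ _ _ h hp hfa
    · exact hadd _ _ _ h hp hfb
    · exact hadd _ _ _ h hfa hfb
    · exact hadd t p c (by rw [h, ht]) (hadd _ _ _ ht hfa hfb) hp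

lemma stabilizer_mulEquiv_perm (p : FanoPoint) :
    Nonempty (↥(fanoAutGroup ⊓ MulAction.stabilizer (Equiv.Perm FanoPoint) p) ≃*
      Equiv.Perm (Fin 4)) := by
  choose F hF using exists_functional_perm p
  let E : Equiv.Perm (FunctionalAt p) →* Function.End FanoPoint :=
    { toFun := F
      map_one' := funext fun x => eq_of_functionalAt fun φ => by
        rw [hF]; rfl
      map_mul' := fun σ τ => funext fun x => eq_of_functionalAt fun φ => by
        change _ = φ.1 ⬝ᵥ (F σ (F τ x)).1
        rw [hF, hF, hF, mul_inv_rev]; rfl }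
  let Θ := E.toHomPerm
  have hΘ : ∀ σ x (φ : FunctionalAt p), φ.1 ⬝ᵥ (Θ σ x).1 = (σ⁻¹ φ).1 ⬝ᵥ x.1 := hF
  have hmem : ∀ σ, Θ σ ∈ fanoAutGroup ⊓ MulAction.stabilizer (Equiv.Perm FanoPoint) p := by
    refine fun σ => ⟨isFanoAut_iff.2 fun x y z h => ?_, eq_of_functionalAt (p := p) fun φ => ?_⟩
    · refine sub_eq_zero.1 (functionalAt_separates p _ fun φ => ?_)
      rw [dotProduct_sub, dotProduct_add, hΘ, hΘ, hΘ, h, dotProduct_add, sub_self]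
    · exact (hΘ σ p φ).trans ((σ⁻¹ φ).2.trans φ.2.symm)
  let Ψ := Θ.codRestrict _ hmem
  have hinj : Function.Injective Ψ := by
    refine (injective_iff_map_eq_one Ψ).2 fun σ hσ => ?_
    have hσ' : Θ σ = 1 := congrArg Subtype.val hσ
    rw [← inv_eq_one]
    refine Equiv.ext fun φ => Subtype.ext (dotProduct_eq _ _ fun v => ?_)
    by_cases hv : v = 0
    · simp [hv]
    · have := hΘ σ ⟨v, hv⟩ φ
      rw [hσ'] at this
      exact this.symm
  have hcard : Nat.card (Equiv.Perm (FunctionalAt p)) = 24 := by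
    rw [Nat.card_eq_fintype_card, Fintype.card_perm, card_functionalAt]; rfl
  have hbij : Function.Bijective Ψ :=
    hinj.bijective_of_nat_card_le ((card_stabilizer_le p).trans_eq hcard.symm)
  exact ⟨(MulEquiv.ofBijective Ψ hbij).symm.trans
    (Fintype.equivFinOfCardEq (card_functionalAt p)).permCongrHom⟩

/-- if `ind(δ) = 3` and the three lines `L` with `δ(L)` a line all pass
through the point `p`, then `G_δ` is the stabilizer of `p` in the full automorphism
group of the Fano plane; in particular `G_δ ≅ S₄`. -/
theorem stmt8 (δ : Equiv.Perm FanoPoint) (h3 : fanoIndex δ = 3) (p : FanoPoint)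
    (hp : ∀ L : Set FanoPoint, IsFanoLine L → IsFanoLine (⇑δ '' L) → p ∈ L) :
    Gdelta δ = fanoAutGroup ⊓ MulAction.stabilizer (Equiv.Perm FanoPoint) p ∧
    Nonempty (↥(Gdelta δ) ≃* Equiv.Perm (Fin 4)) := by
  have h := Gdelta_eq_stabilizer h3 hp
  refine ⟨h, ?_⟩
  rw [h]
  exact stabilizer_mulEquiv_perm p
end

section
/- Let δ be a permutation of the Fano plane F with ind(δ) = 0. Then G_δ contains an element of order 3 and an element of order 7. -/
/-- A permutation of the Fano plane preserving triples of points with sum zero is an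
automorphism. -/
lemma isFanoAut_of_sum_eq_zero {f : Equiv.Perm FanoPoint}
    (hf : ∀ x y z : FanoPoint, x.1 + y.1 + z.1 = 0 → (f x).1 + (f y).1 + (f z).1 = 0) :
    IsFanoAut f := by
  have key : ∀ x y z : FanoPoint, z.1 = x.1 + y.1 → (f z).1 = (f x).1 + (f y).1 := by
    intro x y z h
    have := hf x y z (by rw [h, CharTwo.add_self_eq_zero])
    exact (CharTwo.add_eq_zero.mp this).symm
  rintro _ ⟨x, y, hxy, rfl⟩
  refine ⟨f x, f y, f.injective.ne hxy, ?_⟩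
  ext w
  simp only [Set.mem_image, Set.mem_ofPred_eq]
  constructor
  · rintro ⟨z, h | h | h, rfl⟩
    · exact Or.inl (by rw [Subtype.ext h])
    · exact Or.inr (Or.inl (by rw [Subtype.ext h]))
    · exact Or.inr (Or.inr (key x y z h))
  · rintro (h | h | h)
    · exact ⟨x, Or.inl rfl, (Subtype.ext h).symm⟩
    · exact ⟨y, Or.inr (Or.inl rfl), (Subtype.ext h).symm⟩
    · have hne : x.1 + y.1 ≠ 0 := fun h0 => hxy (Subtype.ext (CharTwo.add_eq_zero.mp h0))
      exact ⟨⟨x.1 + y.1, hne⟩, Or.inr (Or.inr rfl),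
        Subtype.ext ((key x y ⟨_, hne⟩ rfl).trans h.symm)⟩

/-- `f ∈ G_δ` as soon as `f` and its conjugate by `δ` are automorphisms. -/
lemma mem_Gdelta_of_conj {δ f : Equiv.Perm FanoPoint} (hf : IsFanoAut f)
    (hδ : IsFanoAut (δ * f * δ⁻¹)) : f ∈ Gdelta δ := by
  refine ⟨hf, ?_⟩
  rintro _ ⟨L, hL, rfl⟩
  refine ⟨_, hδ L hL, ?_⟩
  ext x
  constructor
  · rintro ⟨y, hy, rfl⟩
    exact ⟨δ y, hy, by simp⟩
  · rintro ⟨y, hy, h⟩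
    exact ⟨δ⁻¹ y, by simpa using hy, δ.injective (by simpa using h)⟩

/-- If `δ` has index zero, then it maps no line to a line. -/
lemma sum_ne_zero_of_fanoIndex_eq_zero {δ : Equiv.Perm FanoPoint} (h0 : fanoIndex δ = 0)
    {x y z : FanoPoint} (h : x.1 + y.1 + z.1 = 0) : (δ x).1 + (δ y).1 + (δ z).1 ≠ 0 := by
  intro hδ
  rw [fanoIndex, Set.ncard_eq_zero (Set.toFinite _)] at h0
  have hz : z.1 = x.1 + y.1 := (CharTwo.add_eq_zero.mp h).symm
  have hz' : (δ z).1 = (δ x).1 + (δ y).1 := (CharTwo.add_eq_zero.mp hδ).symm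
  have hxy : x ≠ y := by
    rintro rfl
    exact z.2 (by rw [hz, CharTwo.add_self_eq_zero])
  refine Set.eq_empty_iff_forall_notMem.mp h0
    {w | w.1 = x.1 ∨ w.1 = y.1 ∨ w.1 = x.1 + y.1} ⟨⟨x, y, hxy, rfl⟩, δ x, δ y,
      δ.injective.ne hxy, ?_⟩
  rw [← hz, ← hz']
  ext w
  simp only [Set.mem_image, Set.mem_ofPred_eq, ← Subtype.ext_iff]
  constructor
  · rintro ⟨v, rfl | rfl | rfl, rfl⟩ <;> simp
  · rintro (rfl | rfl | rfl) <;> simp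

/-- A labelling `ε` of the Fano plane by `ZMod 7` in which the third point of the line through
`i` and `j` is `i + 4 (j - i) + s (j - i) ^ 4`. For `s = -1` the lines are the translates of
`{0, 1, 3}`, for `s = 1` they are the translates of `{0, 2, 3}`. -/
def IsCyclicLabelling (s : ZMod 7) (ε : ZMod 7 ≃ FanoPoint) : Prop :=
  ∀ i j, i ≠ j → (ε i).1 + (ε j).1 + (ε (i + 4 * (j - i) + s * (j - i) ^ 4)).1 = 0

lemma isCyclicLabelling_neg_one {ε : ZMod 7 ≃ FanoPoint}
    (h : ∀ j, (ε j).1 + (ε (j + 1)).1 + (ε (j + 3)).1 = 0) : IsCyclicLabelling (-1) ε := by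
  intro i j hij
  obtain ⟨d, rfl⟩ : ∃ d, j = i + d := ⟨j - i, by ring⟩
  have hd : d ≠ 0 := by rintro rfl; simp at hij
  have h1 := h i
  have h2 := h (i - 1)
  have h3 := h (i - 3)
  rw [add_sub_cancel_left, add_assoc i]
  rw [sub_add_cancel, sub_add_eq_add_sub, add_sub_assoc] at h2
  rw [sub_add_cancel, sub_add_eq_add_sub, add_sub_assoc] at h3
  rw [sub_eq_add_neg] at h2 h3
  have hc : ∀ d : ZMod 7, d ≠ 0 → (d = 1 ∧ 4 * d + -1 * d ^ 4 = 3) ∨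
      (d = 3 ∧ 4 * d + -1 * d ^ 4 = 1) ∨ (d = -1 ∧ 4 * d + -1 * d ^ 4 = 3 - 1) ∨
      (d = 3 - 1 ∧ 4 * d + -1 * d ^ 4 = -1) ∨ (d = -3 ∧ 4 * d + -1 * d ^ 4 = 1 - 3) ∨
      (d = 1 - 3 ∧ 4 * d + -1 * d ^ 4 = -3) := by decide
  rcases hc d hd with ⟨h, h'⟩ | ⟨h, h'⟩ | ⟨h, h'⟩ | ⟨h, h'⟩ | ⟨h, h'⟩ | ⟨h, h'⟩ <;>
    rw [h', h]
  · exact h1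
  · exact .trans (by abel) h1
  · exact .trans (by abel) h2
  · exact .trans (by abel) h2
  · exact .trans (by abel) h3
  · exact .trans (by abel) h3

lemma isCyclicLabelling_one {ε : ZMod 7 ≃ FanoPoint}
    (h : ∀ j, (ε j).1 + (ε (j + 2)).1 + (ε (j + 3)).1 = 0) : IsCyclicLabelling 1 ε := by
  have hneg : IsCyclicLabelling (-1) ((Equiv.neg (ZMod 7)).trans ε) := by
    refine isCyclicLabelling_neg_one fun j => ?_
    have := h (-(j + 3))
    rw [show -(j + 3) + 2 = -(j + 1) by ring, show -(j + 3) + 3 = -j by ring] at this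
    simp only [Equiv.trans_apply, Equiv.neg_apply]
    exact .trans (by abel) this
  intro i j hij
  have := hneg (-i) (-j) (neg_injective.ne hij)
  simp only [Equiv.trans_apply, Equiv.neg_apply, neg_neg] at this
  refine .trans ?_ this
  congr 3
  ring

/-- The affine map `j ↦ u j + t`, with `u ^ 3 = 1`, is an automorphism in any cyclic labelling. -/
lemma IsCyclicLabelling.isFanoAut {s : ZMod 7} {ε : ZMod 7 ≃ FanoPoint}
    (h : IsCyclicLabelling s ε) {u t : ZMod 7} (hu : u ^ 3 = 1) {m : Equiv.Perm (ZMod 7)}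
    (hm : ∀ j, m j = u * j + t) : IsFanoAut ((ε.symm.trans m).trans ε) := by
  apply isFanoAut_of_sum_eq_zero
  intro x y z hxyz
  obtain ⟨i, rfl⟩ := ε.surjective x
  obtain ⟨j, rfl⟩ := ε.surjective y
  obtain ⟨k, rfl⟩ := ε.surjective z
  have hij : i ≠ j := by
    rintro rfl
    rw [CharTwo.add_self_eq_zero, zero_add] at hxyz
    exact (ε k).2 hxyz
  have hk : k = i + 4 * (j - i) + s * (j - i) ^ 4 :=
    ε.injective (Subtype.ext (add_left_cancel (hxyz.trans (h i j hij).symm)))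
  have hmk : m k = m i + 4 * (m j - m i) + s * (m j - m i) ^ 4 := by
    rw [hm, hm, hm, hk]
    linear_combination (-s * u * (j - i) ^ 4) * hu
  simpa [hmk] using h (m i) (m j) (m.injective.ne hij)

/-- The points of the Fano plane, in an order in which the lines are the translates of
`{0, 1, 3}`. -/
def singerPoint : ZMod 7 → FanoPoint :=
  (![⟨![1, 0, 0], by decide⟩, ⟨![0, 1, 0], by decide⟩, ⟨![0, 0, 1], by decide⟩,
    ⟨![1, 1, 0], by decide⟩, ⟨![0, 1, 1], by decide⟩, ⟨![1, 1, 1], by decide⟩,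
    ⟨![1, 0, 1], by decide⟩] : Fin 7 → FanoPoint)

lemma singerPoint_sum (j : ZMod 7) :
    (singerPoint j).1 + (singerPoint (j + 1)).1 + (singerPoint (j + 3)).1 = 0 := by
  revert j
  decide +kernel

lemma singerPoint_bijective : Function.Bijective singerPoint := by
  decide +kernel

/-- A transvection, as a permutation of the labels of the points. -/
def transvectionLabel : ZMod 7 → ZMod 7 :=
  (![0, 1, 6, 3, 5, 4, 2] : Fin 7 → Fin 7)

lemma transvectionLabel_involutive : Function.Involutive transvectionLabel := by
  unfold Function.Involutive
  decide +kernel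

lemma singerPoint_transvection_sum (k j : ZMod 7) :
    (singerPoint (k + transvectionLabel j)).1 + (singerPoint (k + transvectionLabel (j + 1))).1 +
      (singerPoint (k + transvectionLabel (j + 3))).1 = 0 := by
  revert k j
  decide +kernel

/-- The vector `v`, read as a binary number. -/
def binaryCode (v : Fin 3 → ZMod 2) : Fin 8 :=
  Fin.ofNat 8 ((v 0).val + 2 * (v 1).val + 4 * (v 2).val)

lemma binaryCode_injective : Function.Injective binaryCode := by
  decide +kernel

lemma binaryCode_add (v w : Fin 3 → ZMod 2) :
    binaryCode (v + w) = binaryCode v ^^^ binaryCode w := by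
  revert v w
  decide +kernel

lemma linearIndependent_of_sum_ne_zero {x y z : FanoPoint} (hxy : x ≠ y) (hxz : x ≠ z)
    (hyz : y ≠ z) (h : x.1 + y.1 + z.1 ≠ 0) :
    LinearIndependent (ZMod 2) ![x.1, y.1, z.1] := by
  have two : ∀ {u v : FanoPoint}, u ≠ v → u.1 + v.1 ≠ 0 := fun huv h0 =>
    huv (Subtype.ext (CharTwo.add_eq_zero.mp h0))
  have cases : ∀ c : ZMod 2, c = 0 ∨ c = 1 := by decide
  rw [Fintype.linearIndependent_iff]
  intro g hg
  simp only [Fin.sum_univ_three, Matrix.cons_val] at hg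
  rcases cases (g 0) with h0 | h0 <;> rcases cases (g 1) with h1 | h1 <;>
    rcases cases (g 2) with h2 | h2 <;> rw [h0, h1, h2] at hg <;>
    simp only [zero_smul, one_smul, zero_add, add_zero] at hg
  · intro i
    fin_cases i <;> assumption
  · exact absurd hg z.2
  · exact absurd hg y.2
  · exact absurd hg (two hyz)
  · exact absurd hg x.2
  · exact absurd hg (two hxz)
  · exact absurd hg (two hxy)
  · exact absurd hg h

/-- Binary codes with respect to the basis formed by three points not on a line. -/
lemma exists_code {x y z : FanoPoint} (hxy : x ≠ y) (hxz : x ≠ z) (hyz : y ≠ z)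
    (h : x.1 + y.1 + z.1 ≠ 0) :
    ∃ c : (Fin 3 → ZMod 2) → Fin 8, Function.Injective c ∧ c 0 = 0 ∧
      (∀ u v, c (u + v) = c u ^^^ c v) ∧ c x.1 = 1 ∧ c y.1 = 2 ∧ c z.1 = 4 := by
  let b := basisOfLinearIndependentOfCardEqFinrank
    (linearIndependent_of_sum_ne_zero hxy hxz hyz h) (by simp)
  have hb : ⇑b = ![x.1, y.1, z.1] := coe_basisOfLinearIndependentOfCardEqFinrank _ _
  have hc : ∀ i, b.equivFun (![x.1, y.1, z.1] i) = Pi.single i 1 := by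
    intro i
    rw [← hb]
    ext j
    rw [b.equivFun_self, Pi.single_apply]
    simp only [eq_comm]
  refine ⟨fun v => binaryCode (b.equivFun v), binaryCode_injective.comp b.equivFun.injective,
    ?_, fun u v => ?_, ?_, ?_, ?_⟩
  · beta_reduce
    rw [map_zero]
    decide
  · beta_reduce
    rw [map_add, binaryCode_add]
  · exact (congrArg binaryCode (hc 0)).trans (by decide)
  · exact (congrArg binaryCode (hc 1)).trans (by decide)
  · exact (congrArg binaryCode (hc 2)).trans (by decide)

/-- The labelling with the given seven codes. -/
def codeLabelling (a₀ a₁ a₂ a₃ a₄ a₅ a₆ : Fin 8) : ZMod 7 → Fin 8 :=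
  (![a₀, a₁, a₂, a₃, a₄, a₅, a₆] : Fin 7 → Fin 8)

/-- Up to one of eight collineations, the translates of `{0, 2, 3}` are lines in the labelling
given by the codes `a`. -/
def HasRelabelling (a : ZMod 7 → Fin 8) : Prop :=
  (∀ j, a j ^^^ a (j + 2) ^^^ a (j + 3) = 0) ∨
    ∃ k, ∀ j, a (k + transvectionLabel j) ^^^ a (k + transvectionLabel (j + 2)) ^^^
      a (k + transvectionLabel (j + 3)) = 0

instance : DecidablePred HasRelabelling := fun _ => inferInstanceAs (Decidable (_ ∨ _))

/-- An enumeration of the injective labellings by nonzero binary codes in which no translate of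
`{0, 1, 3}` is a line and the labels `0`, `1`, `3` have the codes `1`, `2`, `4`. -/
lemma exists_relabelling_of_codes :
    ∀ a₂ : Fin 8, a₂ ∉ [0, 1, 2, 4] →
    ∀ a₄ : Fin 8, a₄ ∉ [0, 1, 2, a₂, 4] ∧ 2 ^^^ a₂ ^^^ a₄ ≠ 0 →
    ∀ a₅ : Fin 8, a₅ ∉ [0, 1, 2, a₂, 4, a₄] ∧ a₂ ^^^ 4 ^^^ a₅ ≠ 0 ∧ a₄ ^^^ a₅ ^^^ 1 ≠ 0 →
    ∀ a₆ : Fin 8, a₆ ∉ [0, 1, 2, a₂, 4, a₄, a₅] ∧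
      4 ^^^ a₄ ^^^ a₆ ≠ 0 ∧ a₅ ^^^ a₆ ^^^ 2 ≠ 0 ∧ a₆ ^^^ 1 ^^^ a₂ ≠ 0 →
    HasRelabelling (codeLabelling 1 2 a₂ 4 a₄ a₅ a₆) := by
  decide +kernel

lemma exists_relabelling {a : ZMod 7 → Fin 8} (ha : Function.Injective a) (hz : ∀ j, a j ≠ 0)
    (ha₀ : a 0 = 1) (ha₁ : a 1 = 2) (ha₃ : a 3 = 4)
    (h : ∀ j, a j ^^^ a (j + 1) ^^^ a (j + 3) ≠ 0) :
    HasRelabelling a := by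
  have hmem : ∀ (i : ZMod 7) (l : List (ZMod 7)), i ∉ l → a i ∉ 0 :: l.map a := by
    intro i l hi
    simpa [hz i, ha.eq_iff] using hi
  have heq : codeLabelling (a 0) (a 1) (a 2) (a 3) (a 4) (a 5) (a 6) = a := by
    funext i
    fin_cases i <;> rfl
  have mem₂ := hmem 2 [0, 1, 3] (by decide)
  have mem₄ := hmem 4 [0, 1, 2, 3] (by decide)
  have mem₅ := hmem 5 [0, 1, 2, 3, 4] (by decide)
  have mem₆ := hmem 6 [0, 1, 2, 3, 4, 5] (by decide)
  have h₁ : a 1 ^^^ a 2 ^^^ a 4 ≠ 0 := h 1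
  have h₂ : a 2 ^^^ a 3 ^^^ a 5 ≠ 0 := h 2
  have h₃ : a 3 ^^^ a 4 ^^^ a 6 ≠ 0 := h 3
  have h₄ : a 4 ^^^ a 5 ^^^ a 0 ≠ 0 := h 4
  have h₅ : a 5 ^^^ a 6 ^^^ a 1 ≠ 0 := h 5
  have h₆ : a 6 ^^^ a 0 ^^^ a 2 ≠ 0 := h 6
  simp only [List.map_cons, List.map_nil, ha₀, ha₁, ha₃]
    at heq mem₂ mem₄ mem₅ mem₆ h₁ h₂ h₃ h₄ h₅ h₆
  rw [← heq]
  exact exists_relabelling_of_codes (a 2) mem₂ (a 4) ⟨mem₄, h₁⟩ (a 5) ⟨mem₅, h₂, h₄⟩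
    (a 6) ⟨mem₆, h₃, h₅, h₆⟩

/-- If `δ` has index zero, then some labelling by `ZMod 7` is cyclic both for the lines and for
the `δ`-lines. -/
lemma exists_isCyclicLabelling {δ : Equiv.Perm FanoPoint} (h0 : fanoIndex δ = 0) :
    ∃ ε : ZMod 7 ≃ FanoPoint, IsCyclicLabelling (-1) ε ∧ IsCyclicLabelling 1 (ε.trans δ) := by
  let p := Equiv.ofBijective singerPoint singerPoint_bijective
  have hq : Function.Injective fun j => δ (singerPoint j) :=
    δ.injective.comp singerPoint_bijective.1
  have hδ : ∀ j, (δ (singerPoint j)).1 + (δ (singerPoint (j + 1))).1 +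
      (δ (singerPoint (j + 3))).1 ≠ 0 := fun j =>
    sum_ne_zero_of_fanoIndex_eq_zero h0 (singerPoint_sum j)
  obtain ⟨c, hc, hc₀, hadd, hx, hy, hz⟩ :=
    exists_code (hq.ne (by decide)) (hq.ne (by decide)) (hq.ne (by decide)) (hδ 0)
  have hsum : ∀ u v w, c u ^^^ c v ^^^ c w = 0 ↔ u + v + w = 0 := fun u v w => by
    rw [← hadd, ← hadd, ← hc₀, hc.eq_iff]
  rcases exists_relabelling (a := fun j => c (δ (singerPoint j)).1)
    (hc.comp (Subtype.val_injective.comp hq))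
    (fun j hj => (δ (singerPoint j)).2 (hc (hj.trans hc₀.symm))) hx hy hz
    (fun j hj => hδ j ((hsum _ _ _).mp hj)) with H | ⟨k, H⟩
  · exact ⟨p, isCyclicLabelling_neg_one singerPoint_sum,
      isCyclicLabelling_one fun j => (hsum _ _ _).mp (H j)⟩
  · let σ := transvectionLabel_involutive.toPerm.trans (Equiv.addLeft k)
    exact ⟨σ.trans p, isCyclicLabelling_neg_one (singerPoint_transvection_sum k),
      isCyclicLabelling_one fun j => (hsum _ _ _).mp (H j)⟩

/-- Multiplication by `2` on `ZMod 7`. -/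
def doubling : Equiv.Perm (ZMod 7) where
  toFun j := 2 * j
  invFun j := 4 * j
  left_inv := by unfold Function.LeftInverse; decide
  right_inv := by unfold Function.RightInverse Function.LeftInverse; decide

lemma orderOf_doubling : orderOf doubling = 3 :=
  orderOf_eq_prime (by ext j; revert j; decide +kernel)
    fun h => absurd (Equiv.congr_fun h 1) (by decide)

lemma orderOf_addRight_one : orderOf (Equiv.addRight (1 : ZMod 7)) = 7 :=
  have hne : Equiv.addRight (1 : ZMod 7) ≠ 1 := fun h => absurd (Equiv.congr_fun h 0) (by decide)
  have : Fact (Nat.Prime 7) := ⟨by norm_num⟩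
  orderOf_eq_prime (by ext j; revert j; decide +kernel) hne

/-- if `ind(δ) = 0`, then `G_δ` contains an element of order 3 and an
element of order 7. -/
theorem stmt11 (δ : Equiv.Perm FanoPoint) (h0 : fanoIndex δ = 0) :
    (∃ f ∈ Gdelta δ, orderOf f = 3) ∧ (∃ g ∈ Gdelta δ, orderOf g = 7) := by
  obtain ⟨ε, hε, hδ⟩ := exists_isCyclicLabelling h0
  have key : ∀ (m : Equiv.Perm (ZMod 7)) (u t : ZMod 7), u ^ 3 = 1 → (∀ j, m j = u * j + t) →
      ∃ f ∈ Gdelta δ, orderOf f = orderOf m := fun m u t hu hm =>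
    ⟨ε.permCongrHom m, mem_Gdelta_of_conj (hε.isFanoAut hu hm) (hδ.isFanoAut hu hm),
      MulEquiv.orderOf_eq _ _⟩
  refine ⟨?_, ?_⟩
  · rw [← orderOf_doubling]
    exact key doubling 2 0 (by decide) fun j => (add_zero _).symm
  · rw [← orderOf_addRight_one]
    exact key (Equiv.addRight 1) 1 1 (by decide) fun j => by rw [one_mul]; rfl
end
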